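/- arXiv:math/0702159 — 2 statements merged into one kernel-verified Lean document; each statement's English description precedes it below -/
import Mathlib

section
/- Let R be a commutative Noetherian ring, a and b ideals of R, c a natural number, and M a finitely generated R-module with cd_R(a, M) ≤ c. Then there is a natural isomorphism H^c_a(M/bM) ≅ H^c_a(M) / b·H^c_a(M). -/
/- Common definitions: local cohomology modules, cohomological dimension, module dimension,
secondary representations and attached primes. -/

open CategoryTheory TensorProduct

/-- The `i`-th local cohomology module `H^i_a(M)`, as a type with its `R`-module structure. -/
noncomputable def TopLC (R : Type) [CommRing R] (a : Ideal R) (i : ℕ)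
    (M : Type) [AddCommGroup M] [Module R M] : Type :=
  ((localCohomology a i).obj (ModuleCat.of R M))

noncomputable instance (R : Type) [CommRing R] (a : Ideal R) (i : ℕ)
    (M : Type) [AddCommGroup M] [Module R M] : AddCommGroup (TopLC R a i M) :=
  inferInstanceAs (AddCommGroup ((localCohomology a i).obj (ModuleCat.of R M)))

noncomputable instance (R : Type) [CommRing R] (a : Ideal R) (i : ℕ)
    (M : Type) [AddCommGroup M] [Module R M] : Module R (TopLC R a i M) :=
  inferInstanceAs (Module R ((localCohomology a i).obj (ModuleCat.of R M)))

/-- The cohomological dimension `cd_R(a, M) = sup { i | H^i_a(M) ≠ 0 }`,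
with value `⊥` if all local cohomology modules vanish. -/
noncomputable def cohDim (R : Type) [CommRing R] (a : Ideal R)
    (M : Type) [AddCommGroup M] [Module R M] : WithBot ℕ∞ :=
  sSup {n : WithBot ℕ∞ | ∃ i : ℕ, n = (i : ℕ) ∧ Nontrivial (TopLC R a i M)}

/-- The (Krull) dimension of a module, i.e. the Krull dimension of its support. -/
noncomputable def moduleDim (R : Type) [CommRing R]
    (M : Type) [AddCommGroup M] [Module R M] : WithBot ℕ∞ :=
  Order.krullDim (Module.support R M)

/-- `Assh_R M`: the associated primes `p` of `M` with `dim R/p = dim M`. -/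
noncomputable def Assh (R : Type) [CommRing R]
    (M : Type) [AddCommGroup M] [Module R M] : Set (Ideal R) :=
  { p | p ∈ associatedPrimes R M ∧ ringKrullDim (R ⧸ p) = moduleDim R M }

/-- A submodule `S` is secondary if `S ≠ 0` and every `r : R` acts on `S` either
surjectively or nilpotently. -/
def IsSecondarySub (R : Type) [CommRing R] {M : Type} [AddCommGroup M] [Module R M]
    (S : Submodule R M) : Prop :=
  S ≠ ⊥ ∧ ∀ r : R, (∀ m ∈ S, ∃ s ∈ S, r • s = m) ∨ (∃ n : ℕ, ∀ m ∈ S, r ^ n • m = 0)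

/-- A module is representable if it is the (finite) sum of secondary submodules. -/
def IsRepresentable (R : Type) [CommRing R] (M : Type) [AddCommGroup M] [Module R M] : Prop :=
  ∃ (n : ℕ) (S : Fin n → Submodule R M), (∀ i, IsSecondarySub R (S i)) ∧ (⨆ i, S i) = ⊤

/-- A minimal secondary representation: secondary submodules summing to the whole module,
with pairwise distinct attached primes, none contained in the sum of the others. -/
def IsMinimalRep (R : Type) [CommRing R] {M : Type} [AddCommGroup M] [Module R M]
    {n : ℕ} (S : Fin n → Submodule R M) : Prop :=
  (∀ i, IsSecondarySub R (S i)) ∧ (⨆ i, S i) = ⊤ ∧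
    (Function.Injective fun i => (S i).annihilator.radical) ∧
    ∀ j, ¬ (S j ≤ ⨆ i ∈ ({j}ᶜ : Set (Fin n)), S i)

/-- The attached primes of a module: the radicals of the annihilators of the terms of a
minimal secondary representation. -/
def AttachedPrimes (R : Type) [CommRing R] (M : Type) [AddCommGroup M] [Module R M] :
    Set (Ideal R) :=
  { p | ∃ (n : ℕ) (S : Fin n → Submodule R M), IsMinimalRep R S ∧
      ∃ i, p = (S i).annihilator.radical }

/-- `stab b N = ⟨b⟩N = ⋂ₙ bⁿN`. -/
def stab {R M : Type} [CommRing R] [AddCommGroup M] [Module R M]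
    (b : Ideal R) (N : Submodule R M) : Submodule R M :=
  ⨅ n : ℕ, b ^ n • N

universe w v u

namespace ChainComplex

open CategoryTheory Opposite

variable {R : Type*} [CommRing R] (L : ChainComplex (ModuleCat.{v} R)ᵒᵖ ℕ)

/-- The module of cocycles of the cochain complex of modules opposite to `L`. -/
noncomputable abbrev Cocyc (n : ℕ) : ModuleCat.{v} R := unop (L.opcycles n)

/-- The module of cochains of the cochain complex of modules opposite to `L`. -/
noncomputable abbrev Cochain (n : ℕ) : ModuleCat.{v} R := unop (L.X n)

/-- The cohomology of the cochain complex of modules opposite to `L`. -/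
noncomputable abbrev Cohom (n : ℕ) : ModuleCat.{v} R := unop (L.homology n)

/-- The inclusion of cocycles. -/
noncomputable def cocycι (n : ℕ) : L.Cocyc n →ₗ[R] L.Cochain n := (L.pOpcycles n).unop.hom

/-- The projection from cocycles to cohomology. -/
noncomputable def cocycπ (n : ℕ) : L.Cocyc n →ₗ[R] L.Cohom n := (L.homologyι n).unop.hom

lemma cocycι_injective (n : ℕ) : Function.Injective (L.cocycι n) :=
  (ModuleCat.mono_iff_injective (L.pOpcycles n).unop).1 inferInstance

lemma cocycπ_surjective (n : ℕ) : Function.Surjective (L.cocycπ n) :=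
  (ModuleCat.epi_iff_surjective (L.homologyι n).unop).1 inferInstance

lemma d_cocycι (n : ℕ) (z : L.Cocyc n) : (L.d (n + 1) n).unop.hom (L.cocycι n z) = 0 :=
  congr($(congr_arg Quiver.Hom.unop (L.d_pOpcycles (n + 1) n)).hom z)

lemma exists_cocycι_eq (n : ℕ) (f : L.Cochain n) (hf : (L.d (n + 1) n).unop.hom f = 0) :
    ∃ z, L.cocycι n z = f := by
  have h : (ShortComplex.mk _ _ (L.d_pOpcycles (n + 1) n)).Exact :=
    ShortComplex.exact_of_g_is_cokernel _ (L.opcyclesIsCokernel (n + 1) n (by simp))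
  exact (ShortComplex.moduleCat_exact_iff _).1 h.unop f hf

lemma cocycπ_eq_zero_iff (n : ℕ) (z : L.Cocyc (n + 1)) :
    L.cocycπ (n + 1) z = 0 ↔
      ∃ g : L.Cochain n, (L.d (n + 1) n).unop.hom g = L.cocycι (n + 1) z := by
  have h : (ShortComplex.mk _ _ (L.homologyι_comp_fromOpcycles (n + 1) n)).Exact :=
    ShortComplex.exact_of_f_is_kernel _ (L.homologyIsKernel (n + 1) n (by simp))
  have hg (g : L.Cochain n) :
      L.cocycι (n + 1) ((L.fromOpcycles (n + 1) n).unop.hom g) = (L.d (n + 1) n).unop.hom g :=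
    congr($(congr_arg Quiver.Hom.unop (L.p_fromOpcycles (n + 1) n)).hom g)
  constructor
  · intro hz
    obtain ⟨g, hg'⟩ := (ShortComplex.moduleCat_exact_iff _).1 h.unop z hz
    refine ⟨g, (hg g).symm.trans (congr_arg _ hg')⟩
  · rintro ⟨g, hg'⟩
    rw [← hg] at hg'
    rw [← L.cocycι_injective _ hg']
    exact congr($(congr_arg Quiver.Hom.unop (L.homologyι_comp_fromOpcycles (n + 1) n)).hom g)

lemma cocycπ_zero_injective : Function.Injective (L.cocycπ 0) :=
  (ModuleCat.mono_iff_injective (L.homologyι 0).unop).1 inferInstance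

variable {L} {L' : ChainComplex (ModuleCat.{v} R)ᵒᵖ ℕ} (φ : L ⟶ L')

/-- The map induced on cocycles by a morphism of complexes. -/
noncomputable def cocycMap (n : ℕ) : L'.Cocyc n →ₗ[R] L.Cocyc n :=
  (HomologicalComplex.opcyclesMap φ n).unop.hom

lemma cocycι_cocycMap (n : ℕ) (z : L'.Cocyc n) :
    L.cocycι n (cocycMap φ n z) = (φ.f n).unop.hom (L'.cocycι n z) :=
  congr($(congr_arg Quiver.Hom.unop (HomologicalComplex.p_opcyclesMap φ n)).hom z)

lemma cocycπ_cocycMap (n : ℕ) (z : L'.Cocyc n) :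
    L.cocycπ n (cocycMap φ n z) = (HomologicalComplex.homologyMap φ n).unop.hom (L'.cocycπ n z) :=
  congr($(congr_arg Quiver.Hom.unop (HomologicalComplex.homologyι_naturality φ n).symm).hom z)

end ChainComplex

namespace CategoryTheory.ProjectiveResolution

open Abelian Opposite Limits CochainComplex

variable {R : Type*} [CommRing R] {C : Type u} [Category.{v} C] [Abelian C] [Linear R C]
  {X : C} (P : ProjectiveResolution X) (Y : C) (n : ℕ)

/-- The complex of modules `Hom(P, Y)`, seen in the opposite category of modules. -/
noncomputable abbrev opYoneda (R : Type*) [CommRing R] [Linear R C] {X : C}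
    (P : ProjectiveResolution X) (Y : C) : ChainComplex (ModuleCat.{v} R)ᵒᵖ ℕ :=
  (((linearYoneda R C).obj Y).rightOp.mapHomologicalComplex _).obj P.complex

/-- The inclusion of cocycles in `Hom(P, Y)`. -/
noncomputable def cocycHom : (P.opYoneda R Y).Cocyc n →ₗ[R] (P.complex.X n ⟶ Y) :=
  (P.opYoneda R Y).cocycι n

lemma cocycHom_injective : Function.Injective (P.cocycHom (R := R) Y n) :=
  (P.opYoneda R Y).cocycι_injective n

lemma d_comp_cocycHom (z : (P.opYoneda R Y).Cocyc n) :
    P.complex.d (n + 1) n ≫ P.cocycHom Y n z = 0 :=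
  (P.opYoneda R Y).d_cocycι n z

lemma exists_cocycHom_eq (f : P.complex.X n ⟶ Y) (hf : P.complex.d (n + 1) n ≫ f = 0) :
    ∃ z, P.cocycHom (R := R) Y n z = f :=
  (P.opYoneda R Y).exists_cocycι_eq n f hf

/-- The projection from cocycles to the `Ext` of the abelian category. -/
noncomputable def cocycNewExt [HasExt.{w} C] :
    (P.opYoneda R Y).Cocyc n →ₗ[R] Abelian.Ext.{w} X Y n where
  toFun z := P.extMk (P.cocycHom Y n z) (n + 1) rfl (P.d_comp_cocycHom Y n z)
  map_add' x y := by simp [add_extMk]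
  map_smul' r x := by simp [Ext.smul_eq_comp_mk₀, extMk_comp_mk₀]

lemma cocycNewExt_surjective [HasExt.{w} C] :
    Function.Surjective (P.cocycNewExt (R := R) Y n) := by
  intro α
  obtain ⟨f, hf, rfl⟩ := P.extMk_surjective α (n + 1) rfl
  obtain ⟨z, rfl⟩ := P.exists_cocycHom_eq (R := R) Y n f hf
  exact ⟨z, rfl⟩

lemma extMk_degree_zero_eq_zero_iff [HasExt.{w} C] {Y : C} (f : P.complex.X 0 ⟶ Y)
    (hf : P.complex.d (0 + 1) 0 ≫ f = 0) : P.extMk f (0 + 1) rfl hf = 0 ↔ f = 0 := by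
  refine ⟨fun h ↦ ?_, fun h ↦ by subst h; exact P.extMk_zero _ _⟩
  rw [← P.extEquivCohomologyClass.apply_eq_iff_eq, extEquivCohomologyClass_extMk,
    extEquivCohomologyClass_zero, HomComplex.CohomologyClass.mk_eq_zero_iff,
    HomComplex.Cocycle.toSingleMk_mem_coboundaries_iff _ _ _ _ _ 1 (by lia)] at h
  obtain ⟨g, hg⟩ := h
  rw [(P.cochainComplex.isZero_of_isStrictlyLE 0 1 (by lia)).eq_of_src g 0, comp_zero] at hg
  rw [← cancel_epi (P.cochainComplexXIso (-(0 : ℕ)) 0 rfl).hom, ← hg, comp_zero]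

lemma cocycNewExt_eq_zero_iff [HasExt.{w} C] (z : (P.opYoneda R Y).Cocyc n) :
    P.cocycNewExt Y n z = 0 ↔ (P.opYoneda R Y).cocycπ n z = 0 := by
  cases n with
  | zero =>
    rw [map_eq_zero_iff _ (P.opYoneda R Y).cocycπ_zero_injective,
      ← map_eq_zero_iff _ (P.cocycHom_injective Y 0)]
    change P.extMk (P.cocycHom Y 0 z) (0 + 1) rfl (P.d_comp_cocycHom Y 0 z) = 0 ↔
      P.cocycHom Y 0 z = 0
    exact P.extMk_degree_zero_eq_zero_iff _ _
  | succ n =>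
    rw [ChainComplex.cocycπ_eq_zero_iff]
    exact P.extMk_eq_zero_iff (P.cocycHom Y (n + 1) z) (n + 1 + 1) rfl
      (P.d_comp_cocycHom Y (n + 1) z) n rfl

variable [EnoughProjectives C]

/-- The cohomology of `Hom(P, Y)` identifies to the derived functor `Ext`. -/
noncomputable def homologyEquivExt : (P.opYoneda R Y).Cohom n ≃ₗ[R]
    ((_root_.Ext R C n).obj (op X)).obj Y :=
  (P.isoLeftDerivedObj ((linearYoneda R C).obj Y).rightOp n).unop.toLinearEquiv

/-- The two definitions of `Ext` agree. -/
noncomputable def extEquivExt [HasExt.{w} C] :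
    Abelian.Ext.{w} X Y n ≃ₗ[R] ((_root_.Ext R C n).obj (op X)).obj Y :=
  (LinearMap.quotKerEquivOfSurjective _ (P.cocycNewExt_surjective Y n)).symm ≪≫ₗ
    Submodule.quotEquivOfEq _ _ (by ext z; exact P.cocycNewExt_eq_zero_iff Y n z) ≪≫ₗ
    (LinearMap.quotKerEquivOfSurjective _ ((P.opYoneda R Y).cocycπ_surjective n)) ≪≫ₗ
    P.homologyEquivExt Y n

lemma extEquivExt_cocycNewExt [HasExt.{w} C] (z : (P.opYoneda R Y).Cocyc n) :
    P.extEquivExt Y n (P.cocycNewExt Y n z) =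
      P.homologyEquivExt Y n ((P.opYoneda R Y).cocycπ n z) := by
  simp only [extEquivExt, LinearEquiv.trans_apply]
  congr 1
  rw [← LinearMap.quotKerEquivOfSurjective_apply_mk (P.cocycNewExt (R := R) Y n)
      (P.cocycNewExt_surjective Y n) z, LinearEquiv.symm_apply_apply]
  rfl

lemma extEquivExt_comp_mk₀ [HasExt.{w} C] {Y' : C} (g : Y ⟶ Y') (ξ : Abelian.Ext.{w} X Y n) :
    P.extEquivExt (R := R) Y' n (ξ.comp (Ext.mk₀ g) (add_zero n)) =
      (((_root_.Ext R C n).obj (op X)).map g).hom (P.extEquivExt Y n ξ) := by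
  obtain ⟨z, rfl⟩ := P.cocycNewExt_surjective (R := R) Y n ξ
  let φ : P.opYoneda R Y' ⟶ P.opYoneda R Y :=
    (NatTrans.mapHomologicalComplex (NatTrans.rightOp ((linearYoneda R C).map g)) _).app P.complex
  have h : (P.cocycNewExt Y n z).comp (Ext.mk₀ g) (add_zero n) =
      P.cocycNewExt Y' n (ChainComplex.cocycMap φ n z) := by
    refine (P.extMk_comp_mk₀ (P.cocycHom Y n z) (n + 1) rfl (P.d_comp_cocycHom Y n z) g).trans ?_
    simp only [cocycNewExt, LinearMap.coe_mk, AddHom.coe_mk]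
    congr 1
    exact (ChainComplex.cocycι_cocycMap φ n z).symm
  rw [h, extEquivExt_cocycNewExt, extEquivExt_cocycNewExt, ChainComplex.cocycπ_cocycMap]
  have h2 := P.leftDerived_app_eq (NatTrans.rightOp ((linearYoneda R C).map g)) n
  rw [← Category.assoc, Iso.eq_comp_inv] at h2
  exact congr($(congr_arg Quiver.Hom.unop h2.symm).hom ((P.opYoneda R Y).cocycπ n z))

lemma extEquivExt_mk₀_comp [HasExt.{w} C] {X' : C} (P' : ProjectiveResolution X') (g : X' ⟶ X)
    (ξ : Abelian.Ext.{w} X Y n) :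
    P'.extEquivExt (R := R) Y n ((Ext.mk₀ g).comp ξ (zero_add n)) =
      (((_root_.Ext R C n).map g.op).app Y).hom (P.extEquivExt Y n ξ) := by
  obtain ⟨z, rfl⟩ := P.cocycNewExt_surjective (R := R) Y n ξ
  let ψ : Hom P' P g := ⟨lift g P' P, by simpa using lift_commutes_zero g P' P⟩
  let φ : P'.opYoneda R Y ⟶ P.opYoneda R Y :=
    (((linearYoneda R C).obj Y).rightOp.mapHomologicalComplex _).map ψ.hom
  have h : (Ext.mk₀ g).comp (P.cocycNewExt Y n z) (zero_add n) =
      P'.cocycNewExt Y n (ChainComplex.cocycMap φ n z) := by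
    refine (mk₀_comp_extMk (P.cocycHom Y n z) (n + 1) rfl (P.d_comp_cocycHom Y n z) ψ).trans ?_
    simp only [cocycNewExt, LinearMap.coe_mk, AddHom.coe_mk]
    congr 1
    exact (ChainComplex.cocycι_cocycMap φ n z).symm
  rw [h, extEquivExt_cocycNewExt, extEquivExt_cocycNewExt, ChainComplex.cocycπ_cocycMap]
  have h2 := isoLeftDerivedObj_hom_naturality g P' P ψ.hom (lift_commutes_zero g P' P)
    ((linearYoneda R C).obj Y).rightOp n
  exact congr($(congr_arg Quiver.Hom.unop h2.symm).hom ((P.opYoneda R Y).cocycπ n z))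

end CategoryTheory.ProjectiveResolution

namespace localCohomology
open CategoryTheory Opposite Limits Abelian

variable {R : Type} [CommRing R] (a : Ideal R)

/-- The cyclic module `R ⧸ a ^ t`. -/
noncomputable abbrev powQuot (t : ℕ) : ModuleCat.{0} R := ModuleCat.of R (R ⧸ a ^ t)

/-- The projection `R ⧸ a ^ s ⟶ R ⧸ a ^ t` for `t ≤ s`. -/
noncomputable def powQuotMap {t s : ℕ} (h : t ≤ s) : powQuot a s ⟶ powQuot a t :=
  ModuleCat.ofHom (Submodule.mapQ _ _ LinearMap.id (Ideal.pow_le_pow_right h))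

@[simp]
lemma powQuotMap_comp {t s r : ℕ} (h : t ≤ s) (h' : s ≤ r) :
    powQuotMap a h' ≫ powQuotMap a h = powQuotMap a (h.trans h') := by
  apply ModuleCat.hom_ext
  ext
  rfl

variable {a} {i : ℕ} {N N' : ModuleCat.{0} R}

/-- The pullback of extension classes along `R ⧸ a ^ s ⟶ R ⧸ a ^ t`. -/
noncomputable abbrev extRes {t s : ℕ} (h : t ≤ s) (ξ : Ext.{0} (powQuot a t) N i) :
    Ext.{0} (powQuot a s) N i :=
  (Ext.mk₀ (powQuotMap a h)).comp ξ (zero_add i)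

lemma extRes_extRes {t s r : ℕ} (h : t ≤ s) (h' : s ≤ r) (ξ : Ext.{0} (powQuot a t) N i) :
    extRes h' (extRes h ξ) = extRes (h.trans h') ξ := by
  simp [extRes]

variable (i N) in
/-- The canonical map from `Ext` to local cohomology. -/
noncomputable def ofExt (t : ℕ) :
    Ext.{0} (powQuot a t) N i →ₗ[R] (localCohomology a i).obj N :=
  ((colimit.ι (diagram (idealPowersDiagram a) i) (op (op t))).app N).hom.comp
    ((projectiveResolution (powQuot a t)).extEquivExt N i).toLinearMap

lemma map_ofExt (g : N ⟶ N') (t : ℕ) (ξ : Ext.{0} (powQuot a t) N i) :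
    ((localCohomology a i).map g).hom (ofExt i N t ξ) =
      ofExt i N' t (ξ.comp (Ext.mk₀ g) (add_zero i)) := by
  have h := (colimit.ι (diagram (idealPowersDiagram a) i) (op (op t))).naturality g
  refine (congr($(h.symm).hom ((projectiveResolution (powQuot a t)).extEquivExt N i ξ))).trans ?_
  exact congr_arg ((colimit.ι (diagram (idealPowersDiagram a) i) (op (op t))).app N').hom
    (ProjectiveResolution.extEquivExt_comp_mk₀ _ _ _ g ξ).symm

variable (a i N) in
/-- The local cohomology of a fixed module is a colimit of `Ext` modules. -/
noncomputable def isColimitEvaluation :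
    IsColimit (((evaluation _ _).obj N).mapCocone
      (colimit.cocone (diagram (idealPowersDiagram a) i))) :=
  isColimitOfPreserves _ (colimit.isColimit _)

lemma diagram_map_extEquivExt {t s : ℕ} (h : t ≤ s) (ξ : Ext.{0} (powQuot a t) N i) :
    (((diagram (idealPowersDiagram a) i).map (homOfLE h).op.op).app N).hom
      ((projectiveResolution (powQuot a t)).extEquivExt N i ξ) =
    (projectiveResolution (powQuot a s)).extEquivExt N i (extRes h ξ) :=
  (ProjectiveResolution.extEquivExt_mk₀_comp _ _ _ _ (powQuotMap a h) ξ).symm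

lemma ofExt_extRes {t s : ℕ} (h : t ≤ s) (ξ : Ext.{0} (powQuot a t) N i) :
    ofExt i N s (extRes h ξ) = ofExt i N t ξ := by
  refine (congr_arg ((colimit.ι (diagram (idealPowersDiagram a) i) (op (op s))).app N).hom
    (diagram_map_extEquivExt h ξ).symm).trans ?_
  have := colimit.w (diagram (idealPowersDiagram a) i) (homOfLE h).op.op
  exact congr(($(this).app N).hom ((projectiveResolution (powQuot a t)).extEquivExt N i ξ))

lemma exists_ofExt (x : (localCohomology a i).obj N) :
    ∃ t ξ, ofExt i N t ξ = x := by
  obtain ⟨⟨⟨t⟩⟩, y, hy⟩ := Concrete.isColimit_exists_rep _ (isColimitEvaluation a i N) x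
  obtain ⟨ξ, rfl⟩ := ((projectiveResolution (powQuot a t)).extEquivExt N i).surjective y
  exact ⟨t, ξ, hy⟩

lemma ofExt_eq_zero_iff {t : ℕ} (ξ : Ext.{0} (powQuot a t) N i) :
    ofExt i N t ξ = 0 ↔ ∃ (s : ℕ) (h : t ≤ s), extRes h ξ = 0 := by
  constructor
  · intro hξ
    rw [← map_zero (ofExt i N t)] at hξ
    obtain ⟨⟨⟨s⟩⟩, f, g, hfg⟩ := Concrete.isColimit_exists_of_rep_eq
      (i := op (op t)) (j := op (op t)) _ (isColimitEvaluation a i N)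
      ((projectiveResolution (powQuot a t)).extEquivExt N i ξ)
      ((projectiveResolution (powQuot a t)).extEquivExt N i 0) hξ
    have h : t ≤ s := leOfHom f.unop.unop
    refine ⟨s, h, ?_⟩
    apply ((projectiveResolution (powQuot a s)).extEquivExt (R := R) N i).injective
    have hg := diagram_map_extEquivExt h (0 : Ext.{0} (powQuot a t) N i)
    rw [extRes, Ext.comp_zero] at hg
    rw [← diagram_map_extEquivExt, ← hg]
    exact hfg
  · rintro ⟨s, h, hs⟩
    rw [← ofExt_extRes h, hs, map_zero]

lemma subsingleton_iff : Subsingleton ((localCohomology a i).obj N) ↔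
    ∀ (t : ℕ) (ξ : Ext.{0} (powQuot a t) N i), ∃ (s : ℕ) (h : t ≤ s), extRes h ξ = 0 := by
  constructor
  · intro _ t ξ
    exact (ofExt_eq_zero_iff ξ).1 (Subsingleton.elim _ _)
  · refine fun H ↦ subsingleton_of_forall_eq 0 fun x ↦ ?_
    obtain ⟨t, ξ, rfl⟩ := exists_ofExt x
    exact (ofExt_eq_zero_iff ξ).2 (H t ξ)

end localCohomology

namespace localCohomology
open CategoryTheory Opposite Limits Abelian

variable {R : Type} [CommRing R] {a : Ideal R} {i : ℕ}

lemma extRes_comp {N N' : ModuleCat.{0} R} {t s : ℕ} (h : t ≤ s) (ξ : Ext.{0} (powQuot a t) N i)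
    {j k : ℕ} (ζ : Ext.{0} N N' j) (hk : i + j = k) :
    extRes h (ξ.comp ζ hk) = (extRes h ξ).comp ζ hk :=
  (Ext.comp_assoc _ _ _ (zero_add i) hk (by lia)).symm

lemma extRes_zero {N : ModuleCat.{0} R} {t s : ℕ} (h : t ≤ s) :
    extRes h (0 : Ext.{0} (powQuot a t) N i) = 0 :=
  Ext.comp_zero _ _ _ _ _

variable {S : ShortComplex (ModuleCat.{0} R)} (hS : S.ShortExact)
include hS

lemma exists_map_f_eq (x : (localCohomology a i).obj S.X₂)
    (hx : ((localCohomology a i).map S.g).hom x = 0) :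
    ∃ y, ((localCohomology a i).map S.f).hom y = x := by
  obtain ⟨t, ξ, rfl⟩ := exists_ofExt x
  rw [map_ofExt, ofExt_eq_zero_iff] at hx
  obtain ⟨s, h, hs⟩ := hx
  rw [extRes_comp] at hs
  obtain ⟨η, hη⟩ := Ext.covariant_sequence_exact₂ _ hS _ hs
  exact ⟨ofExt i _ s η, by rw [map_ofExt, hη, ofExt_extRes]⟩

lemma map_g_surjective [Subsingleton ((localCohomology a (i + 1)).obj S.X₁)] :
    Function.Surjective ((localCohomology a i).map S.g).hom := by
  intro x
  obtain ⟨t, ξ, rfl⟩ := exists_ofExt x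
  obtain ⟨s, h, hs⟩ := subsingleton_iff.1 ‹_› t (ξ.comp hS.extClass rfl)
  rw [extRes_comp] at hs
  obtain ⟨η, hη⟩ := Ext.covariant_sequence_exact₃ _ hS _ rfl hs
  exact ⟨ofExt i _ s η, by rw [map_ofExt, hη, ofExt_extRes]⟩

lemma subsingleton_X₁_of_surjective [Subsingleton ((localCohomology a (i + 1)).obj S.X₂)]
    (hg : Function.Surjective ((localCohomology a i).map S.g).hom) :
    Subsingleton ((localCohomology a (i + 1)).obj S.X₁) := by
  refine subsingleton_iff.2 fun t ξ ↦ ?_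
  obtain ⟨s, h, hs⟩ := subsingleton_iff.1 ‹_› t (ξ.comp (Ext.mk₀ S.f) (add_zero _))
  rw [extRes_comp] at hs
  obtain ⟨η, hη⟩ := Ext.covariant_sequence_exact₁ _ hS _ hs rfl
  obtain ⟨x, hx⟩ := hg (ofExt i _ s η)
  obtain ⟨t', ζ, rfl⟩ := exists_ofExt x
  rw [← ofExt_extRes (le_max_left s t'), ← ofExt_extRes (le_max_right s t'), map_ofExt,
    ← sub_eq_zero, ← map_sub, ofExt_eq_zero_iff] at hx
  obtain ⟨r, hr, hx⟩ := hx
  refine ⟨r, h.trans ((le_max_left s t').trans hr), ?_⟩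
  rw [extRes, sub_eq_add_neg, Ext.comp_add, Ext.comp_neg, ← sub_eq_add_neg, sub_eq_zero] at hx
  rw [← extRes_extRes h ((le_max_left s t').trans hr), ← hη, extRes_comp,
    ← extRes_extRes (le_max_left s t') hr, extRes, ← hx,
    ← extRes, extRes_comp, Ext.comp_assoc _ _ _ (add_zero i) (zero_add 1) (by lia),
    hS.comp_extClass, Ext.comp_zero]

lemma subsingleton_X₁ [Subsingleton ((localCohomology a (i + 1)).obj S.X₂)]
    [Subsingleton ((localCohomology a i).obj S.X₃)] :
    Subsingleton ((localCohomology a (i + 1)).obj S.X₁) :=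
  subsingleton_X₁_of_surjective hS fun _ ↦ ⟨0, Subsingleton.elim _ _⟩

lemma subsingleton_X₂ [Subsingleton ((localCohomology a i).obj S.X₁)]
    [Subsingleton ((localCohomology a i).obj S.X₃)] :
    Subsingleton ((localCohomology a i).obj S.X₂) := by
  refine subsingleton_of_forall_eq 0 fun x ↦ ?_
  obtain ⟨y, rfl⟩ := exists_map_f_eq hS x (Subsingleton.elim _ _)
  rw [Subsingleton.elim y 0, map_zero]

lemma subsingleton_X₃ [Subsingleton ((localCohomology a (i + 1)).obj S.X₁)]
    [Subsingleton ((localCohomology a i).obj S.X₂)] :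
    Subsingleton ((localCohomology a i).obj S.X₃) :=
  (map_g_surjective hS (a := a) (i := i)).subsingleton

omit hS in
lemma subsingleton_of_injective (E : ModuleCat.{0} R) [Injective E] :
    Subsingleton ((localCohomology a (i + 1)).obj E) :=
  subsingleton_iff.2 fun t ξ ↦ ⟨t, le_rfl, by rw [ξ.eq_zero_of_injective, extRes_zero]⟩

end localCohomology

section Torsion

variable {R : Type} [CommRing R] {M N : Type} [AddCommGroup M] [AddCommGroup N]
  [Module R M] [Module R N]

/-- An element of a module is `a`-power torsion if it is killed by a power of the ideal `a`. -/
def IsPowTorsion (a : Ideal R) (z : M) : Prop := ∃ t : ℕ, ∀ r ∈ a ^ t, r • z = 0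

namespace IsPowTorsion

variable {a b : Ideal R} {z w : M}

lemma smul (h : IsPowTorsion a z) (r : R) : IsPowTorsion a (r • z) := by
  obtain ⟨t, ht⟩ := h
  exact ⟨t, fun s hs ↦ by rw [smul_comm, ht s hs, smul_zero]⟩

lemma map (h : IsPowTorsion a z) (f : M →ₗ[R] N) : IsPowTorsion a (f z) := by
  obtain ⟨t, ht⟩ := h
  exact ⟨t, fun s hs ↦ by rw [← map_smul, ht s hs, map_zero]⟩

lemma sub (h : IsPowTorsion a z) (h' : IsPowTorsion a w) : IsPowTorsion a (z - w) := by
  obtain ⟨t, ht⟩ := h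
  obtain ⟨s, hs⟩ := h'
  refine ⟨max t s, fun r hr ↦ ?_⟩
  rw [smul_sub, ht r (Ideal.pow_le_pow_right (le_max_left _ _) hr),
    hs r (Ideal.pow_le_pow_right (le_max_right _ _) hr), sub_zero]

lemma mono (h : IsPowTorsion b z) (hab : a ≤ b) : IsPowTorsion a z := by
  obtain ⟨t, ht⟩ := h
  exact ⟨t, fun s hs ↦ ht s (Ideal.pow_right_mono hab t hs)⟩

lemma sup_span_singleton (h : IsPowTorsion a z) {x : R} {k : ℕ} (hx : x ^ k • z = 0) :
    IsPowTorsion (a ⊔ Ideal.span {x}) z := by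
  obtain ⟨t, ht⟩ := h
  refine ⟨t + k, fun s hs ↦ ?_⟩
  have hs' := Ideal.sup_pow_add_le_pow_sup_pow hs
  rw [Ideal.span_singleton_pow, Submodule.mem_sup] at hs'
  obtain ⟨y, hy, y', hy', rfl⟩ := hs'
  obtain ⟨c, rfl⟩ := Ideal.mem_span_singleton'.1 hy'
  rw [add_smul, ht y hy, mul_smul, hx, smul_zero, add_zero]

lemma exists_pow_smul_eq_zero (h : IsPowTorsion a z) {x : R} (hx : x ∈ a) :
    ∃ k : ℕ, x ^ k • z = 0 := by
  obtain ⟨t, ht⟩ := h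
  exact ⟨t, ht _ (Ideal.pow_mem_pow hx t)⟩

/-- Torsion elements of an injective module are divisible by `x ^ k` up to `x`-power torsion. -/
lemma exists_pow_smul_eq [IsNoetherianRing R] [Module.Injective R M] (h : IsPowTorsion a z)
    (x : R) (k : ℕ) :
    ∃ (u : M) (l : ℕ), IsPowTorsion a u ∧ x ^ (l + k) • u = x ^ l • z := by
  obtain ⟨t, ht⟩ := h
  let I : ℕ →o Ideal R :=
    { toFun := fun l ↦ Submodule.comap (LinearMap.lsmul R R (x ^ l)) (a ^ t)
      monotone' := fun l m hlm r (hr : x ^ l * r ∈ a ^ t) ↦ by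
        change x ^ m * r ∈ a ^ t
        rw [← Nat.sub_add_cancel hlm, pow_add, mul_assoc]
        exact Ideal.mul_mem_left _ _ hr }
  obtain ⟨l, hl⟩ := monotone_stabilizes_iff_noetherian.2 ‹IsNoetherianRing R› I
  have hI (r : R) (hr : x ^ (l + k) * r ∈ a ^ t) : x ^ l * r ∈ a ^ t :=
    (hl (l + k) (by lia)).ge (x := r) hr
  let f : (R ⧸ I (l + k)) →ₗ[R] R ⧸ a ^ t :=
    Submodule.mapQ _ _ (LinearMap.lsmul R R (x ^ (l + k))) le_rfl
  have hf : Function.Injective f := by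
    rw [injective_iff_map_eq_zero]
    intro r hr
    obtain ⟨r, rfl⟩ := Submodule.Quotient.mk_surjective _ r
    exact (Submodule.Quotient.mk_eq_zero _).2 ((Submodule.Quotient.mk_eq_zero (a ^ t)).1 hr)
  let g : (R ⧸ I (l + k)) →ₗ[R] M :=
    Submodule.liftQ _ (LinearMap.toSpanSingleton R M (x ^ l • z)) fun r hr ↦ by
      rw [LinearMap.mem_ker, LinearMap.toSpanSingleton_apply, smul_smul, mul_comm]
      exact ht _ (hI r hr)
  obtain ⟨h, hh⟩ := Module.Injective.out f hf g
  refine ⟨h (Submodule.Quotient.mk 1), l, ⟨t, fun r hr ↦ ?_⟩, ?_⟩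
  · rw [← map_smul, ← Submodule.Quotient.mk_smul, smul_eq_mul, mul_one,
      (Submodule.Quotient.mk_eq_zero _).2 hr, map_zero]
  · have := hh (Submodule.Quotient.mk 1)
    rw [← map_smul]
    exact this.trans (one_smul R _)

end IsPowTorsion

/-- Sections with support of an exact complex of injectives have no cohomology in degrees above
the number of generators. -/
lemma exists_isPowTorsion_of_card [IsNoetherianRing R] {E : ℕ → Type}
    [∀ i, AddCommGroup (E i)] [∀ i, Module R (E i)] [∀ i, Module.Injective R (E i)]
    (d : ∀ i, E i →ₗ[R] E (i + 1)) (hd : ∀ i, Function.Exact (d i) (d (i + 1)))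
    (s : Finset R) (i : ℕ) (hi : s.card ≤ i) (z : E (i + 1)) (hz : d (i + 1) z = 0)
    (hs : IsPowTorsion (Ideal.span (s : Set R)) z) :
    ∃ w : E i, IsPowTorsion (Ideal.span (s : Set R)) w ∧ d i w = z := by
  classical
  induction s using Finset.induction generalizing i with
  | empty =>
    obtain ⟨w, hw⟩ := (hd i z).1 hz
    refine ⟨w, ⟨1, fun r hr ↦ ?_⟩, hw⟩
    simp only [Finset.coe_empty, Ideal.span_empty, pow_one, Ideal.mem_bot] at hr
    rw [hr, zero_smul]
  | insert x s hx ih =>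
    rw [Finset.card_insert_of_notMem hx] at hi
    rw [Finset.coe_insert, Ideal.span_insert, sup_comm] at hs ⊢
    obtain ⟨j, rfl⟩ : ∃ j, i = j + 1 := ⟨i - 1, by lia⟩
    obtain ⟨k, hk⟩ := hs.exists_pow_smul_eq_zero
      (Ideal.mem_sup_right (Ideal.mem_span_singleton_self x))
    obtain ⟨w, hw, rfl⟩ := ih (j + 1) (by lia) z hz (hs.mono le_sup_left)
    obtain ⟨v, hv, hvw⟩ := ih j (by lia) (x ^ k • w) (by rw [map_smul, hk]) (hw.smul _)
    obtain ⟨u, l, hu, huv⟩ := hv.exists_pow_smul_eq x k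
    refine ⟨w - d j u, (hw.sub (hu.map _)).sup_span_singleton (x := x) (k := l + k) ?_, ?_⟩
    · rw [smul_sub, ← map_smul, huv, map_smul, hvw, smul_smul, ← pow_add, sub_self]
    · rw [map_sub, (hd j).apply_apply_eq_zero, sub_zero]

end Torsion

namespace localCohomology
open CategoryTheory Opposite Limits Abelian

variable {R : Type} [CommRing R] {a : Ideal R}

lemma map_zero_surjective {N N' : ModuleCat.{0} R} (g : N ⟶ N')
    (hg : ∀ z : N', IsPowTorsion a z → ∃ w : N, IsPowTorsion a w ∧ g.hom w = z) :
    Function.Surjective ((localCohomology a 0).map g).hom := by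
  intro x
  obtain ⟨t, ξ, rfl⟩ := exists_ofExt x
  obtain ⟨f, rfl⟩ := (Ext.mk₀_bijective _ _).2 ξ
  have hf : IsPowTorsion a (f.hom (Submodule.Quotient.mk 1)) := by
    refine IsPowTorsion.map ⟨t, fun r hr ↦ ?_⟩ _
    rw [← Submodule.Quotient.mk_smul, smul_eq_mul, mul_one]
    exact (Submodule.Quotient.mk_eq_zero _).2 hr
  obtain ⟨w, ⟨s, hs⟩, hw⟩ := hg _ hf
  let e : powQuot a (max t s) ⟶ N := ModuleCat.ofHom <|
    Submodule.liftQ _ (LinearMap.toSpanSingleton R N w) fun r hr ↦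
      hs r (Ideal.pow_le_pow_right (le_max_right t s) hr)
  have he : e ≫ g = powQuotMap a (le_max_left t s) ≫ f := by
    refine ModuleCat.hom_ext (Submodule.linearMap_qext _ (LinearMap.ext_ring ?_))
    refine Eq.trans ?_ hw
    exact congr_arg _ (one_smul R w)
  refine ⟨ofExt 0 N (max t s) (Ext.mk₀ e), ?_⟩
  rw [map_ofExt, Ext.mk₀_comp_mk₀, he, ← ofExt_extRes (le_max_left t s), extRes,
    Ext.mk₀_comp_mk₀]

/-- Dimension shifting along an injective coresolution. -/
lemma subsingleton_of_coresolution (i : ℕ) {E : ℕ → Type}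
    [∀ i, AddCommGroup (E i)] [∀ i, Module R (E i)] [∀ i, Module.Injective R (E i)]
    (d : ∀ i, E i →ₗ[R] E (i + 1)) (hd : ∀ i, Function.Exact (d i) (d (i + 1)))
    (hE : ∀ z : E (i + 1), d (i + 1) z = 0 → IsPowTorsion a z →
      ∃ w : E i, IsPowTorsion a w ∧ d i w = z)
    {N : Type} [AddCommGroup N] [Module R N] (e : N →ₗ[R] E 0) (he : Function.Injective e)
    (hed : Function.Exact e (d 0)) :
    Subsingleton ((localCohomology a (i + 1)).obj (ModuleCat.of R N)) := by
  induction i generalizing E N with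
  | zero =>
    have hS := ModuleCat.shortComplex_shortExact
      (ModuleCat.shortComplexOfCompEqZero e (d 0).rangeRestrict
        (LinearMap.ext fun x ↦ Subtype.ext (hed.apply_apply_eq_zero x)))
      (fun y ↦ Subtype.ext_iff.trans (hed y)) he (d 0).surjective_rangeRestrict
    have : Injective (ModuleCat.of R (E 0)) := Module.injective_object_of_injective_module R (E 0)
    have : Subsingleton ((localCohomology a (0 + 1)).obj (ModuleCat.of R (E 0))) :=
      subsingleton_of_injective _
    refine subsingleton_X₁_of_surjective hS (map_zero_surjective _ fun z hz ↦ ?_)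
    obtain ⟨w, hw, h⟩ := hE z.1 ((hd 0 _).2 z.2) (hz.map (LinearMap.range (d 0)).subtype)
    exact ⟨w, hw, Subtype.ext h⟩
  | succ i ih =>
    have hS := ModuleCat.shortComplex_shortExact
      (ModuleCat.shortComplexOfCompEqZero e (d 0).rangeRestrict
        (LinearMap.ext fun x ↦ Subtype.ext (hed.apply_apply_eq_zero x)))
      (fun y ↦ Subtype.ext_iff.trans (hed y)) he (d 0).surjective_rangeRestrict
    have : Injective (ModuleCat.of R (E 0)) := Module.injective_object_of_injective_module R (E 0)
    have : Subsingleton ((localCohomology a (i + 1 + 1)).obj (ModuleCat.of R (E 0))) :=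
      subsingleton_of_injective _
    have := ih (E := fun i ↦ E (i + 1)) (fun i ↦ d (i + 1)) (fun i ↦ hd (i + 1)) hE
      (LinearMap.range (d 0)).subtype Subtype.val_injective (fun y ↦ by
        simpa using hd 0 y)
    exact subsingleton_X₁ hS

/-- Local cohomology vanishes above the number of generators of the ideal. -/
lemma subsingleton_of_card_le [IsNoetherianRing R] (s : Finset R) (i : ℕ) (hi : s.card ≤ i)
    (N : ModuleCat.{0} R) :
    Subsingleton ((localCohomology (Ideal.span (s : Set R)) (i + 1)).obj N) := by
  let I := injectiveResolution N
  have (j : ℕ) : Module.Injective R (I.cocomplex.X j) :=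
    have : Injective (ModuleCat.of R (I.cocomplex.X j)) := I.injective j
    Module.injective_module_of_injective_object R _
  have hd (j : ℕ) : Function.Exact (I.cocomplex.d j (j + 1)).hom
      (I.cocomplex.d (j + 1) (j + 1 + 1)).hom :=
    (ShortComplex.ShortExact.moduleCat_exact_iff_function_exact _).1 (I.exact_succ j)
  refine subsingleton_of_coresolution (N := N) i (E := fun j ↦ I.cocomplex.X j)
    (fun j ↦ (I.cocomplex.d j (j + 1)).hom) hd
    (exists_isPowTorsion_of_card (fun j ↦ (I.cocomplex.d j (j + 1)).hom) hd s i hi)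
    (I.ι.f 0).hom ?_ ?_
  · exact (ModuleCat.mono_iff_injective (I.ι.f 0)).1 inferInstance
  · exact (ShortComplex.ShortExact.moduleCat_exact_iff_function_exact _).1 I.exact₀

end localCohomology

section Support

variable {R M : Type} [CommRing R] [AddCommGroup M] [Module R M] [Module.Finite R M]

/-- A finite module admits a nonzero map to its residue domain at a point of the support. -/
lemma Module.exists_linearMap_quotient_ne_zero {p : PrimeSpectrum R}
    (hp : p ∈ Module.support R M) : ∃ f : M →ₗ[R] R ⧸ p.asIdeal, f ≠ 0 := by
  have := (Module.mem_support_iff_nontrivial_residueField_tensorProduct (R := R) (M := M) p).1 hp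
  let K := p.asIdeal.ResidueField
  obtain ⟨m, hm⟩ : ∃ m : M, (1 : K) ⊗ₜ[R] m ≠ 0 := by
    by_contra! h
    obtain ⟨x, hx⟩ := exists_ne (0 : K ⊗[R] M)
    refine hx ?_
    induction x with
    | zero => rfl
    | tmul k m => rw [← mul_one k, ← smul_eq_mul, ← TensorProduct.smul_tmul', h, smul_zero]
    | add x y hx hy => simp_all
  obtain ⟨φ, hφ⟩ : ∃ φ : Module.Dual K (K ⊗[R] M), φ (1 ⊗ₜ[R] m) ≠ 0 := by
    by_contra! h
    exact hm ((Module.forall_dual_apply_eq_zero_iff K _).1 h)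
  let ψ : M →ₗ[R] K := φ.restrictScalars R ∘ₗ TensorProduct.mk R K M 1
  obtain ⟨s, hs⟩ := Module.Finite.fg_top (R := R) (M := M)
  obtain ⟨b, hb⟩ := IsLocalization.exist_integer_multiples (nonZeroDivisors (R ⧸ p.asIdeal)) s ψ
  let ι : (R ⧸ p.asIdeal) →ₗ[R] K := (Algebra.linearMap (R ⧸ p.asIdeal) K).restrictScalars R
  have hι : Function.Injective ι := p.asIdeal.injective_algebraMap_quotient_residueField
  let θ : M →ₗ[R] K := LinearMap.lsmul (R ⧸ p.asIdeal) K b.1 |>.restrictScalars R |>.comp ψ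
  have hθ : LinearMap.range θ ≤ LinearMap.range ι := by
    rw [LinearMap.range_eq_map, ← hs, Submodule.map_span_le]
    exact fun m hm ↦ hb m hm
  refine ⟨(LinearEquiv.ofInjective ι hι).symm.toLinearMap ∘ₗ
    θ.codRestrict _ (fun x ↦ hθ ⟨x, rfl⟩), fun h ↦ hφ ?_⟩
  have h0 : θ m = 0 := by
    have := congr_arg (LinearEquiv.ofInjective ι hι) (LinearMap.congr_fun h m)
    simpa using congr_arg Subtype.val this
  have hb0 : algebraMap (R ⧸ p.asIdeal) K b.1 ≠ 0 :=
    map_ne_zero_of_mem_nonZeroDivisors _ hι b.2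
  have h1 : algebraMap (R ⧸ p.asIdeal) K b.1 * ψ m = 0 := by
    rw [← Algebra.smul_def]; exact h0
  exact (mul_eq_zero.1 h1).resolve_left hb0

omit [Module.Finite R M] in
/-- The support of a proper quotient of a residue domain consists of larger primes. -/
lemma Module.lt_of_mem_support_quotient {p q : PrimeSpectrum R}
    {J : Submodule R (R ⧸ p.asIdeal)} (hJ : J ≠ ⊥)
    (hq : q ∈ Module.support R ((R ⧸ p.asIdeal) ⧸ J)) : p < q := by
  have hann := Module.annihilator_le_of_mem_support hq
  have hpq : p.asIdeal ≤ q.asIdeal := by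
    refine le_trans (fun r hr ↦ ?_) hann
    rw [Module.mem_annihilator]
    intro x
    obtain ⟨x, rfl⟩ := Submodule.Quotient.mk_surjective _ x
    obtain ⟨x, rfl⟩ := Submodule.Quotient.mk_surjective _ x
    rw [← Submodule.Quotient.mk_smul, ← Submodule.Quotient.mk_smul, smul_eq_mul,
      (Submodule.Quotient.mk_eq_zero _).2 (Ideal.mul_mem_right _ _ hr), Submodule.Quotient.mk_zero]
  obtain ⟨x, hx, hx0⟩ := J.exists_mem_ne_zero_of_ne_bot hJ
  obtain ⟨s, rfl⟩ := Submodule.Quotient.mk_surjective _ x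
  have hs : s ∈ q.asIdeal := by
    refine hann (Module.mem_annihilator.2 fun y ↦ ?_)
    obtain ⟨y, rfl⟩ := Submodule.Quotient.mk_surjective _ y
    obtain ⟨y, rfl⟩ := Submodule.Quotient.mk_surjective _ y
    rw [← Submodule.Quotient.mk_smul, Submodule.Quotient.mk_eq_zero, ← Submodule.Quotient.mk_smul,
      smul_eq_mul, mul_comm, ← smul_eq_mul, Submodule.Quotient.mk_smul]
    exact J.smul_mem y hx
  refine lt_of_le_not_ge hpq fun h ↦ hx0 ((Submodule.Quotient.mk_eq_zero _).2 (h hs))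

end Support

namespace localCohomology

open Abelian

variable {R : Type} [CommRing R] {a : Ideal R} {i : ℕ}

lemma map_sum_smul {ι : Type} [Fintype ι] {N N' : ModuleCat.{0} R} (r : ι → R) (f : ι → (N ⟶ N'))
    (x : (localCohomology a i).obj N) :
    ((localCohomology a i).map (∑ j, r j • f j)).hom x =
      ∑ j, r j • ((localCohomology a i).map (f j)).hom x := by
  obtain ⟨t, ξ, rfl⟩ := exists_ofExt x
  simp only [map_ofExt, Ext.mk₀_sum, Ext.mk₀_smul, Ext.comp_sum, Ext.comp_smul, map_sum, map_smul]

lemma map_smul_eq_zero {N N' : ModuleCat.{0} R} (r : R) (f : N ⟶ N') (hf : r • f = 0)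
    (x : (localCohomology a i).obj N) :
    ((localCohomology a i).map f).hom (r • x) = 0 := by
  obtain ⟨t, ξ, rfl⟩ := exists_ofExt x
  rw [map_smul, map_ofExt, ← map_smul, ← Ext.comp_smul, ← Ext.mk₀_smul, hf, Ext.mk₀_zero,
    Ext.comp_zero, map_zero]

section Exact

variable {N₁ N₂ N₃ : Type} [AddCommGroup N₁] [Module R N₁] [AddCommGroup N₂] [Module R N₂]
  [AddCommGroup N₃] [Module R N₃] {f : N₁ →ₗ[R] N₂} {g : N₂ →ₗ[R] N₃}

lemma shortExact_of_exact (hfg : Function.Exact f g) (hf : Function.Injective f)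
    (hg : Function.Surjective g) :
    (ModuleCat.shortComplexOfCompEqZero f g hfg.linearMap_comp_eq_zero).ShortExact :=
  ModuleCat.shortComplex_shortExact _ hfg hf hg

end Exact

lemma subsingleton_of_linearEquiv {N N' : Type} [AddCommGroup N] [Module R N] [AddCommGroup N']
    [Module R N'] (e : N ≃ₗ[R] N')
    (h : Subsingleton ((localCohomology a i).obj (ModuleCat.of R N'))) :
    Subsingleton ((localCohomology a i).obj (ModuleCat.of R N)) :=
  ((localCohomology a i).mapIso e.toModuleIso).toLinearEquiv.toEquiv.subsingleton

variable [IsNoetherianRing R]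

/-- Vanishing of local cohomology of a finite module can be tested on residue domains. -/
lemma subsingleton_of_forall_prime (N : Type) [AddCommGroup N] [Module R N] [Module.Finite R N]
    (h : ∀ p : PrimeSpectrum R, Module.annihilator R N ≤ p.asIdeal →
      Subsingleton ((localCohomology a i).obj (ModuleCat.of R (R ⧸ p.asIdeal)))) :
    Subsingleton ((localCohomology a i).obj (ModuleCat.of R N)) := by
  revert h
  induction ‹Module.Finite R N› using
    IsNoetherianRing.induction_on_isQuotientEquivQuotientPrime R with
  | subsingleton N =>
    intro _
    refine subsingleton_of_forall_eq 0 fun x ↦ ?_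
    have := map_smul_eq_zero 1 (𝟙 (ModuleCat.of R N))
      (ModuleCat.hom_ext (LinearMap.ext fun y ↦ Subsingleton.elim (α := N) _ _)) x
    simpa using this
  | quotient N p e =>
    intro h
    refine subsingleton_of_linearEquiv e (h p ?_)
    rw [e.annihilator_eq, Ideal.annihilator_quotient]
  | exact N₁ N₂ N₃ f g hf hg hfg h₁ h₃ =>
    intro h
    have := h₁ fun p hp ↦ h p ((f.annihilator_le_of_injective hf).trans hp)
    have := h₃ fun p hp ↦ h p ((g.annihilator_le_of_surjective hg).trans hp)
    exact subsingleton_X₂ (shortExact_of_exact hfg hf hg)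

variable (M : Type) [AddCommGroup M] [Module R M] [Module.Finite R M]

/-- The inductive step of Gruson-type descent for the vanishing of local cohomology. -/
lemma subsingleton_of_annihilator_le_aux
    (h₁ : ∀ (N : Type) [AddCommGroup N] [Module R N] [Module.Finite R N],
      Module.annihilator R M ≤ Module.annihilator R N →
      Subsingleton ((localCohomology a (i + 1)).obj (ModuleCat.of R N)))
    (h₂ : Subsingleton ((localCohomology a i).obj (ModuleCat.of R M)))
    (N : Type) [AddCommGroup N] [Module R N] [Module.Finite R N]
    (hN : Module.annihilator R M ≤ Module.annihilator R N) :
    Subsingleton ((localCohomology a i).obj (ModuleCat.of R N)) := by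
  refine subsingleton_of_forall_prime N fun p hp ↦ ?_
  replace hp := hN.trans hp
  clear! N
  induction hP : p.asIdeal using WellFoundedGT.induction generalizing p with | ind P ih => ?_
  subst hP
  obtain ⟨f, hf⟩ := Module.exists_linearMap_quotient_ne_zero (Module.mem_support_iff_of_finite.2 hp)
  have := h₁ (LinearMap.ker f) (f.ker.subtype.annihilator_le_of_injective Subtype.val_injective)
  have hJ : Subsingleton ((localCohomology a i).obj (ModuleCat.of R (LinearMap.range f))) :=
    subsingleton_X₃ (shortExact_of_exact (f := f.ker.subtype) (g := f.rangeRestrict)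
      (LinearMap.exact_iff.2 (by simp)) Subtype.val_injective f.surjective_rangeRestrict)
  have hQ : Subsingleton ((localCohomology a i).obj
      (ModuleCat.of R ((R ⧸ p.asIdeal) ⧸ LinearMap.range f))) := by
    refine subsingleton_of_forall_prime _ fun q hq ↦ ?_
    have hpq := Module.lt_of_mem_support_quotient (fun h ↦ hf (LinearMap.range_eq_bot.1 h))
      (Module.mem_support_iff_of_finite.2 hq)
    exact ih q.asIdeal hpq q (hp.trans hpq.le) rfl
  exact subsingleton_X₂ (shortExact_of_exact (f := f.range.subtype) (g := f.range.mkQ)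
    (LinearMap.exact_iff.2 (by simp)) Subtype.val_injective (Submodule.mkQ_surjective _))

/-- Vanishing of the local cohomology of `M` above degree `c` passes to every finite module
whose annihilator contains that of `M`. -/
lemma subsingleton_of_annihilator_le {c : ℕ}
    (hM : ∀ i, c < i → Subsingleton ((localCohomology a i).obj (ModuleCat.of R M)))
    (hi : c < i) (N : Type) [AddCommGroup N] [Module R N] [Module.Finite R N]
    (hN : Module.annihilator R M ≤ Module.annihilator R N) :
    Subsingleton ((localCohomology a i).obj (ModuleCat.of R N)) := by
  obtain ⟨s, rfl⟩ := (isNoetherianRing_iff_ideal_fg R).1 ‹_› a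
  obtain ⟨d, hd⟩ : ∃ d, s.card < i + d := ⟨s.card + 1, by lia⟩
  induction d generalizing i N with
  | zero =>
    obtain ⟨i, rfl⟩ := Nat.exists_eq_succ_of_ne_zero hi.ne_bot
    exact subsingleton_of_card_le s i (by lia) _
  | succ d ih =>
    exact subsingleton_of_annihilator_le_aux M
      (fun N _ _ _ hN ↦ ih (by lia) N hN (by lia)) (hM i hi) N hN

variable {M}

lemma map_mkQ_surjective_and_ker_eq (b : Ideal R) {c : ℕ}
    (hM : ∀ i, c < i → Subsingleton ((localCohomology a i).obj (ModuleCat.of R M))) :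
    let π := ModuleCat.ofHom (b • (⊤ : Submodule R M)).mkQ
    Function.Surjective ((localCohomology a c).map π).hom ∧
      LinearMap.ker ((localCohomology a c).map π).hom = b • ⊤ := by
  intro π
  have hSES := shortExact_of_exact (f := (b • (⊤ : Submodule R M)).subtype)
    (g := (b • (⊤ : Submodule R M)).mkQ)
    (LinearMap.exact_iff.2 (by simp)) Subtype.val_injective (Submodule.mkQ_surjective _)
  have := subsingleton_of_annihilator_le M hM c.lt_succ_self ↥(b • (⊤ : Submodule R M))
    (LinearMap.annihilator_le_of_injective (Submodule.subtype _) Subtype.val_injective)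
  refine ⟨map_g_surjective hSES, le_antisymm (fun x hx ↦ ?_) (Submodule.smul_le.2 fun r hr x _ ↦
    map_smul_eq_zero r π (ModuleCat.hom_ext (LinearMap.ext fun m ↦ ?_)) x)⟩
  · obtain ⟨y, rfl⟩ := exists_map_f_eq hSES x hx
    obtain ⟨s, hs⟩ := (isNoetherianRing_iff_ideal_fg R).1 ‹_› b
    have hsb (j : s) : (j : R) ∈ b := hs ▸ Submodule.subset_span j.2
    let φ : (s → M) →ₗ[R] M := ∑ j : s, (j : R) • LinearMap.proj j
    have hφ : LinearMap.range φ = b • ⊤ := by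
      classical
      refine le_antisymm ?_ (Submodule.smul_le.2 fun r hr m _ ↦ ?_)
      · rintro _ ⟨x, rfl⟩
        simp only [φ, LinearMap.sum_apply, LinearMap.smul_apply]
        exact Submodule.sum_mem _ fun j _ ↦ Submodule.smul_mem_smul (hsb j) trivial
      · obtain ⟨t, rfl⟩ := Submodule.mem_span_finset'.1 (hs ▸ hr)
        exact ⟨fun j ↦ t j • m, by simp [φ, Finset.sum_smul, smul_smul, mul_comm]⟩
    let ψ : (s → M) →ₗ[R] ↥(b • (⊤ : Submodule R M)) := φ.codRestrict _ fun x ↦ hφ ▸ ⟨x, rfl⟩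
    have hψ : Function.Surjective ψ := by
      rintro ⟨y, hy⟩
      obtain ⟨x, rfl⟩ := hφ.ge hy
      exact ⟨x, rfl⟩
    have hSES' := shortExact_of_exact (f := ψ.ker.subtype) (g := ψ)
      (LinearMap.exact_iff.2 (by simp)) Subtype.val_injective hψ
    have := subsingleton_of_annihilator_le M hM c.lt_succ_self ψ.ker
      (le_trans (by rw [Module.annihilator_pi]; exact le_iInf fun _ ↦ le_rfl)
        (LinearMap.annihilator_le_of_injective (Submodule.subtype _) Subtype.val_injective))
    obtain ⟨z, rfl⟩ := map_g_surjective hSES' (a := a) (i := c) y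
    have key : ((localCohomology a c).map (∑ j : s, (j : R) •
        ModuleCat.ofHom (LinearMap.proj (R := R) (φ := fun _ : s ↦ M) j))).hom z ∈
        b • (⊤ : Submodule R ((localCohomology a c).obj (ModuleCat.of R M))) := by
      rw [map_sum_smul]
      exact Submodule.sum_mem _ fun j _ ↦ Submodule.smul_mem_smul (hsb j) trivial
    have hcomp : ModuleCat.ofHom ψ ≫ ModuleCat.ofHom (b • (⊤ : Submodule R M)).subtype =
        ∑ j : s, (j : R) • ModuleCat.ofHom (LinearMap.proj (R := R) (φ := fun _ : s ↦ M) j) := by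
      refine ModuleCat.hom_ext ?_
      simp only [ModuleCat.hom_sum, ModuleCat.hom_smul]
      rfl
    rw [← hcomp, Functor.map_comp] at key
    exact key
  · exact (Submodule.Quotient.mk_eq_zero _).2 (Submodule.smul_mem_smul hr trivial)

end localCohomology

/-- For ideals `a`, `b` of a Noetherian ring `R`, `c : ℕ`, and a finitely
generated module `M` with `cd_R(a, M) ≤ c`, there is an isomorphism
`H^c_a(M/bM) ≅ H^c_a(M) / b·H^c_a(M)`. -/
theorem stmt_10 (R : Type) [CommRing R] [IsNoetherianRing R] (a b : Ideal R) (c : ℕ)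
    (M : Type) [AddCommGroup M] [Module R M] [Module.Finite R M]
    (hc : cohDim R a M ≤ (c : WithBot ℕ∞)) :
    Nonempty ((TopLC R a c (M ⧸ (b • (⊤ : Submodule R M)))) ≃ₗ[R]
      ((TopLC R a c M) ⧸ (b • (⊤ : Submodule R (TopLC R a c M))))) := by
  have hM (i : ℕ) (hi : c < i) :
      Subsingleton ((localCohomology a i).obj (ModuleCat.of R M)) := by
    by_contra h
    have hle : ((i : ℕ) : WithBot ℕ∞) ≤ cohDim R a M :=
      le_sSup ⟨i, rfl, not_subsingleton_iff_nontrivial.1 h⟩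
    exact hi.not_ge (by exact_mod_cast hle.trans hc)
  obtain ⟨hsurj, hker⟩ := localCohomology.map_mkQ_surjective_and_ker_eq b hM
  exact ⟨((Submodule.quotEquivOfEq _ _ hker.symm).trans
    (LinearMap.quotKerEquivOfSurjective _ hsurj)).symm⟩
end

section
/- Let R be a commutative Noetherian ring, a an ideal of R, and M a finitely generated R-module with c := cd_R(a, M) ≠ −∞ (i.e. H^i_a(M) ≠ 0 for some i). Let W be the set of primes p ∈ Supp_R M with dim R/p = c and cd_R(a, R/p) = c, let X := W ∩ Ass_R M, and let b := ∩_{p ∈ X} p. Then P_{a,R/b} ⊆ Supp_R H^c_a(M). -/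
/- Common definitions: local cohomology modules, cohomological dimension, module dimension,
secondary representations and attached primes. -/

open CategoryTheory TensorProduct

/-- The set `P_{a,M}` of primes `p ⊇ Ann M + a` for which there is a prime `p*` in the
support of the completed localization `(M_p)^` over `(R_p)^` with `dim (R_p)^/p* = d`
and `dim (R_p)^/(a (R_p)^ + p*) = 0`. -/
noncomputable def Pset (R : Type) [CommRing R] (a : Ideal R)
    (M : Type) [AddCommGroup M] [Module R M] (d : ℕ) : Set (PrimeSpectrum R) :=
  fun p =>
    Module.annihilator R M ⊔ a ≤ p.asIdeal ∧
    ∃ q : PrimeSpectrum (AdicCompletion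
        (IsLocalRing.maximalIdeal (Localization.AtPrime p.asIdeal))
        (Localization.AtPrime p.asIdeal)),
      q ∈ Module.support
          (AdicCompletion (IsLocalRing.maximalIdeal (Localization.AtPrime p.asIdeal))
            (Localization.AtPrime p.asIdeal))
          (AdicCompletion (IsLocalRing.maximalIdeal (Localization.AtPrime p.asIdeal))
            (LocalizedModule p.asIdeal.primeCompl M)) ∧
      ringKrullDim (AdicCompletion (IsLocalRing.maximalIdeal (Localization.AtPrime p.asIdeal))
          (Localization.AtPrime p.asIdeal) ⧸ q.asIdeal) = (d : WithBot ℕ∞) ∧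
      ringKrullDim (AdicCompletion (IsLocalRing.maximalIdeal (Localization.AtPrime p.asIdeal))
          (Localization.AtPrime p.asIdeal) ⧸
          (Ideal.map (algebraMap (Localization.AtPrime p.asIdeal)
              (AdicCompletion (IsLocalRing.maximalIdeal (Localization.AtPrime p.asIdeal))
                (Localization.AtPrime p.asIdeal)))
            (Ideal.map (algebraMap R (Localization.AtPrime p.asIdeal)) a) ⊔ q.asIdeal)) =
        (0 : WithBot ℕ∞)

section Comparison
open Opposite HomologicalComplex

variable {R : Type} [CommRing R] {X X' Y : ModuleCat.{0} R}

/-- Precomposition with a chain map, on Hom complexes. -/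
noncomputable def linearYonedaMap {K L : ChainComplex (ModuleCat.{0} R) ℕ} (φ : K ⟶ L)
    (Y : ModuleCat.{0} R) : L.linearYonedaObj R Y ⟶ K.linearYonedaObj R Y :=
  (unopFunctor _ _).map
    ((((linearYoneda R _).obj Y).rightOp.mapHomologicalComplex (ComplexShape.down ℕ)).map φ).op

lemma comp_comp_eq_of_squares {D : Type*} [Category* D] {A A' B B' C C' : D} {m : A ⟶ A'}
    {u : A ⟶ B} {u' : A' ⟶ B'} {w : B ⟶ B'} {v : B ⟶ C} {v' : B' ⟶ C'} {t : C ⟶ C'}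
    (h₁ : m ≫ u' = u ≫ w) (h₂ : w ≫ v' = v ≫ t) : m ≫ (u' ≫ v') = (u ≫ v) ≫ t := by
  rw [Category.assoc, ← h₂, reassoc_of% h₁]

lemma isoExt_hom_naturality (P : ProjectiveResolution X) (P' : ProjectiveResolution X')
    {h : X' ⟶ X} (φ : P'.Hom P h) (n : ℕ) :
    ((Ext R (ModuleCat.{0} R) n).map h.op).app Y ≫ (P'.isoExt (R := R) n Y).hom =
      (P.isoExt n Y).hom ≫ homologyMap (linearYonedaMap φ.hom Y) n := by
  have h1 := ProjectiveResolution.isoLeftDerivedObj_inv_naturality h P' P φ.hom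
    (by simpa using φ.hom_f_zero_comp_π_f_zero) ((linearYoneda R (ModuleCat.{0} R)).obj Y).rightOp n
  have h2 := CommSq.mk (homologyOp_hom_naturality (linearYonedaMap φ.hom Y) n)
  have h2 := h2.vert_inv.w.symm
  exact comp_comp_eq_of_squares (congrArg Quiver.Hom.unop h1) (congrArg Quiver.Hom.unop h2)

lemma smul_extMk (P : ProjectiveResolution X) {n m : ℕ} (s : R) (f : P.complex.X n ⟶ Y)
    (hm : n + 1 = m) (hf : P.complex.d m n ≫ f = 0) :
    s • P.extMk f m hm hf = P.extMk (s • f) m hm (by simp [hf]) := by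
  rw [Abelian.Ext.smul_eq_comp_mk₀, ProjectiveResolution.extMk_comp_mk₀]
  simp only [Linear.comp_smul, Category.comp_id]

lemma exists_cycle (K : CochainComplex (ModuleCat.{0} R) ℕ) {n : ℕ} (f : K.X n)
    (hf : (K.d n (n + 1)).hom f = 0) : ∃ z : K.cycles n, (K.iCycles n).hom z = f :=
  ⟨K.cyclesMk f (n + 1) (by simp) hf, K.i_cyclesMk f (n + 1) (by simp) hf⟩

lemma exists_boundary (K : CochainComplex (ModuleCat.{0} R) ℕ) {n : ℕ} (z : K.cycles n)
    (hz : (K.homologyπ n).hom z = 0) (j : ℕ) (hj : (ComplexShape.up ℕ).prev n = j) :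
    ∃ g : K.X j, (K.d j n).hom g = (K.iCycles n).hom z := by
  have ex := ShortComplex.exact_of_g_is_cokernel
    (.mk (K.toCycles j n) (K.homologyπ n) (by simp)) (K.homologyIsCokernel j n hj)
  rw [ShortComplex.moduleCat_exact_iff] at ex
  obtain ⟨g, hg⟩ := ex z hz
  refine ⟨g, ?_⟩
  rw [← hg]
  exact (congrArg (fun t => t.hom g) (K.toCycles_i _ n)).symm

/-- Vanishing in the old model of `Ext` (derived functor in the first variable)
implies vanishing in the model defined through the derived category. -/
theorem exists_ext_comparison (n : ℕ) (e : Abelian.Ext X Y n) :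
    ∃ x : ((Ext R (ModuleCat.{0} R) n).obj (op X)).obj Y,
      ∀ (X' : ModuleCat.{0} R) (h : X' ⟶ X) (s : R),
        s • (((Ext R (ModuleCat.{0} R) n).map h.op).app Y).hom x = 0 →
          s • (Abelian.Ext.mk₀ h).comp e (zero_add n) = 0 := by
  let P := projectiveResolution X
  obtain ⟨f, hf, rfl⟩ := P.extMk_surjective e (n + 1) rfl
  let K := P.complex.linearYonedaObj R Y
  obtain ⟨z, hz⟩ := exists_cycle K (n := n) f hf
  refine ⟨(P.isoExt n Y).inv.hom ((K.homologyπ n).hom z), fun X' h s hs => ?_⟩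
  let P' := projectiveResolution X'
  let φ : P'.Hom P h := ⟨ProjectiveResolution.lift h P' P,
    (ProjectiveResolution.lift_commutes_zero h P' P).trans (by simp)⟩
  rw [ProjectiveResolution.mk₀_comp_extMk _ _ _ _ φ, smul_extMk]
  let K' := P'.complex.linearYonedaObj R Y
  have h1 : (K'.homologyπ n).hom (s • (cyclesMap (linearYonedaMap φ.hom Y) n).hom z) = 0 := by
    have h2 := congrArg (P'.isoExt (R := R) n Y).hom.hom hs
    rw [map_smul, map_zero] at h2
    have h3 := congrArg (fun t => t.hom ((P.isoExt n Y).inv.hom ((K.homologyπ n).hom z)))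
      (isoExt_hom_naturality (Y := Y) P P' φ n)
    have h4 := congrArg (fun t => t.hom ((K.homologyπ n).hom z)) (P.isoExt (R := R) n Y).inv_hom_id
    have h5 := congrArg (fun t => t.hom z) (homologyπ_naturality (linearYonedaMap φ.hom Y) n)
    rw [map_smul]
    refine Eq.trans ?_ h2
    congr 1
    refine Eq.trans h5.symm (Eq.trans ?_ h3.symm)
    exact congrArg (homologyMap (linearYonedaMap φ.hom Y) n).hom h4.symm
  have h6 : (K'.iCycles n).hom (s • (cyclesMap (linearYonedaMap φ.hom Y) n).hom z) =
      s • (φ.hom.f n ≫ f) := by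
    rw [map_smul]
    congr 1
    refine (congrArg (fun t => t.hom z) (cyclesMap_i (linearYonedaMap φ.hom Y) n)).trans ?_
    exact congrArg ((linearYonedaMap φ.hom Y).f n).hom hz
  rcases n with _ | p
  · obtain ⟨g, hg⟩ := exists_boundary K' _ h1 0 (by simp)
    have : K'.d 0 0 = 0 := K'.shape _ _ (by simp)
    rw [h6, this] at hg
    have h7 : s • (φ.hom.f 0 ≫ f) = 0 := hg.symm
    simp only [h7, ProjectiveResolution.extMk_zero]
  · rw [ProjectiveResolution.extMk_eq_zero_iff _ _ _ _ _ p rfl]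
    obtain ⟨g, hg⟩ := exists_boundary K' _ h1 p (by simp)
    exact ⟨g, hg.trans h6⟩

/-- The canonical surjection `R/a^m → R/a^n` for `n ≤ m`. -/
noncomputable def powTransition (a : Ideal R) {n m : ℕ} (h : n ≤ m) :
    ModuleCat.of R (R ⧸ a ^ m) ⟶ ModuleCat.of R (R ⧸ a ^ n) :=
  ModuleCat.ofHom (Submodule.mapQ _ _ LinearMap.id (Ideal.pow_le_pow_right h))

theorem exists_smul_transition_eq_zero (a : Ideal R) (i : ℕ) (M : Type) [AddCommGroup M]
    [Module R M] (S : Set R) (hS : ∀ x : TopLC R a i M, ∃ s ∈ S, s • x = 0) (n : ℕ)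
    (e : Abelian.Ext (ModuleCat.of R (R ⧸ a ^ n)) (ModuleCat.of R M) i) :
    ∃ (m : ℕ) (h : n ≤ m), ∃ s ∈ S,
      s • (Abelian.Ext.mk₀ (powTransition a h)).comp e (zero_add i) = 0 := by
  obtain ⟨x, hx⟩ := exists_ext_comparison i e
  let F := localCohomology.diagram (localCohomology.idealPowersDiagram a) i
  let G := F ⋙ (evaluation (ModuleCat.{0} R) (ModuleCat.{0} R)).obj (ModuleCat.of R M)
  let c : Limits.Cocone G :=
    ((evaluation (ModuleCat.{0} R) (ModuleCat.{0} R)).obj (ModuleCat.of R M)).mapCocone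
      (Limits.colimit.cocone F)
  have hc : Limits.IsColimit c := Limits.isColimitOfPreserves _ (Limits.colimit.isColimit F)
  let y : TopLC R a i M := (c.ι.app (op (op n))).hom x
  obtain ⟨s, hs, hsy⟩ := hS y
  have h0 : (c.ι.app (op (op n))).hom (s • x) = (c.ι.app (op (op n))).hom 0 :=
    ((c.ι.app (op (op n))).hom.map_smul s x).trans
      (hsy.trans (c.ι.app (op (op n))).hom.map_zero.symm)
  obtain ⟨k, f, g, hfg⟩ := Limits.Concrete.isColimit_exists_of_rep_eq G hc _ _ h0
  have h1 : (G.map f).hom (s • x) = 0 := hfg.trans (map_zero (G.map g).hom)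
  refine ⟨k.unop.unop, leOfHom f.unop.unop, s, hs, hx _ _ s ?_⟩
  exact ((G.map f).hom.map_smul s x).symm.trans h1

end Comparison

section LC
open Abelian

variable {R : Type} [CommRing R] (a : Ideal R)

/-- The terms of the direct system computing local cohomology. -/
abbrev ExtPow (i : ℕ) (N : ModuleCat.{0} R) (n : ℕ) : Type :=
  Abelian.Ext (ModuleCat.of R (R ⧸ a ^ n)) N i

/-- The transition maps of the direct system computing local cohomology. -/
noncomputable abbrev extPowMap (i : ℕ) (N : ModuleCat.{0} R) (n m : ℕ) (h : n ≤ m) :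
    ExtPow a i N n →ₗ[R] ExtPow a i N m :=
  Ext.precompOfLinear (Ext.mk₀ (powTransition a h)) R N (zero_add i)

lemma powTransition_comp {n m k : ℕ} (h : n ≤ m) (h' : m ≤ k) :
    powTransition a h' ≫ powTransition a h = powTransition a (h.trans h') := by
  ext; rfl

lemma powTransition_refl (n : ℕ) : powTransition a (le_refl n) = 𝟙 _ := by
  ext; rfl

instance (i : ℕ) (N : ModuleCat.{0} R) :
    DirectedSystem (ExtPow a i N) (fun n m h => extPowMap a i N n m h) where
  map_self n x := by simp [powTransition_refl]
  map_map k j i hij hjk x := by simp [powTransition_comp]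

/-- Local cohomology as the direct limit of `Ext^i(R/a^n, N)`. -/
abbrev LCCat (i : ℕ) (N : ModuleCat.{0} R) : Type :=
  Module.DirectLimit (ExtPow a i N) (extPowMap a i N)

namespace LCCat
variable {a} {i : ℕ} {N N' : ModuleCat.{0} R}

noncomputable abbrev of (n : ℕ) : ExtPow a i N n →ₗ[R] LCCat a i N :=
  Module.DirectLimit.of R ℕ _ _ n

lemma of_trans {n m : ℕ} (h : n ≤ m) (e : ExtPow a i N n) :
    of m (extPowMap a i N n m h e) = of n e := Module.DirectLimit.of_f

/-- Postcomposition with an `Ext` class. -/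
noncomputable def op {p j : ℕ} (β : Abelian.Ext N N' p) (h : i + p = j) :
    LCCat a i N →ₗ[R] LCCat a j N' :=
  Module.DirectLimit.map (fun n => Ext.postcompOfLinear β R _ h) (fun n m hnm => by
    ext e
    simp only [LinearMap.comp_apply, LinearMap.flip_apply, Ext.bilinearCompOfLinear_apply_apply]
    rw [Ext.comp_assoc _ _ _ _ h (by lia)])

lemma op_of {p j : ℕ} (β : Abelian.Ext N N' p) (h : i + p = j) (n : ℕ) (e : ExtPow a i N n) :
    op β h (of n e) = of n (e.comp β h) :=
  Module.DirectLimit.map_apply_of _ _ _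

lemma exists_of (x : LCCat a i N) : ∃ n e, of n e = x := Module.DirectLimit.exists_of x

lemma of_eq_zero {n : ℕ} {e : ExtPow a i N n} (h : of n e = 0) :
    ∃ m, ∃ hm : n ≤ m, (Ext.mk₀ (powTransition a hm)).comp e (zero_add i) = 0 :=
  Module.DirectLimit.of.zero_exact h

end LCCat

/-- Local cohomology of an unbundled module. -/
abbrev LC (i : ℕ) (N : Type) [AddCommGroup N] [Module R N] : Type := LCCat a i (ModuleCat.of R N)

namespace LC
open LCCat
variable {a} {i : ℕ} {N N' N'' : Type} [AddCommGroup N] [Module R N] [AddCommGroup N'] [Module R N']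
  [AddCommGroup N''] [Module R N'']

noncomputable def map (a : Ideal R) (i : ℕ) (f : N →ₗ[R] N') : LC a i N →ₗ[R] LC a i N' :=
  op (Ext.mk₀ (ModuleCat.ofHom f)) (add_zero i)

lemma map_comp (f : N →ₗ[R] N') (g : N' →ₗ[R] N'') (x : LC a i N) :
    map a i (g ∘ₗ f) x = map a i g (map a i f x) := by
  obtain ⟨n, e, rfl⟩ := exists_of x
  simp [map, op_of]

lemma map_smul_id (r : R) (x : LC a i N) : map a i (r • LinearMap.id) x = r • x := by
  obtain ⟨n, e, rfl⟩ := exists_of x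
  rw [map, op_of, ← _root_.map_smul, Ext.smul_eq_comp_mk₀]
  rfl

lemma map_id (x : LC a i N) : map a i LinearMap.id x = x := by
  simpa using map_smul_id (1 : R) x

/-- Elements of local cohomology are torsion. -/
lemma exists_pow_smul_eq_zero (x : LC a i N) : ∃ n, ∀ r ∈ a ^ n, r • x = 0 := by
  obtain ⟨n, e, rfl⟩ := exists_of x
  refine ⟨n, fun r hr => ?_⟩
  have h1 : (r • 𝟙 (ModuleCat.of R (R ⧸ a ^ n))) = 0 := by
    ext
    change r • (1 : R ⧸ a ^ n) = 0
    rw [Algebra.smul_def, mul_one, Ideal.Quotient.algebraMap_eq]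
    exact Ideal.Quotient.eq_zero_iff_mem.2 hr
  have h2 : r • e = 0 := by
    rw [← Ext.mk₀_id_comp e, ← Ext.smul_comp, ← Ext.mk₀_smul, h1, Ext.mk₀_zero, Ext.zero_comp]
  rw [← _root_.map_smul, h2, map_zero]

section Exact
variable {f : N →ₗ[R] N'} {g : N' →ₗ[R] N''}

lemma shortExact (hf : Function.Injective f) (hfg : Function.Exact f g)
    (hg : Function.Surjective g) :
    (ShortComplex.mk (ModuleCat.ofHom f) (ModuleCat.ofHom g)
      (by ext x; exact hfg.apply_apply_eq_zero x)).ShortExact where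
  exact := (ShortComplex.moduleCat_exact_iff _).2 fun x hx => (hfg x).1 hx
  mono_f := (ModuleCat.mono_iff_injective _).2 hf
  epi_g := (ModuleCat.epi_iff_surjective _).2 hg

lemma exact₂ (hf : Function.Injective f) (hfg : Function.Exact f g)
    (hg : Function.Surjective g) {x : LC a i N'} (hx : map a i g x = 0) :
    ∃ y, map a i f y = x := by
  obtain ⟨n, e, rfl⟩ := exists_of x
  rw [map, op_of] at hx
  obtain ⟨m, hm, h⟩ := of_eq_zero hx
  rw [← Ext.comp_assoc_of_third_deg_zero] at h
  obtain ⟨y, hy⟩ := Ext.covariant_sequence_exact₂ _ (shortExact hf hfg hg) _ h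
  refine ⟨of m y, ?_⟩
  rw [map, op_of, ← of_trans hm]
  exact congrArg (of m) hy

/-- The connecting homomorphism. -/
noncomputable def δ (a : Ideal R) (i : ℕ) (hf : Function.Injective f) (hfg : Function.Exact f g)
    (hg : Function.Surjective g) : LC a i N'' →ₗ[R] LC a (i + 1) N :=
  op (shortExact hf hfg hg).extClass rfl

lemma exact₃ (hf : Function.Injective f) (hfg : Function.Exact f g)
    (hg : Function.Surjective g) {x : LC a i N''} (hx : δ a i hf hfg hg x = 0) :
    ∃ y, map a i g y = x := by
  obtain ⟨n, e, rfl⟩ := exists_of x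
  rw [δ, op_of] at hx
  obtain ⟨m, hm, h⟩ := of_eq_zero hx
  rw [← Ext.comp_assoc _ _ _ (zero_add i) rfl (by lia)] at h
  obtain ⟨y, hy⟩ := Ext.covariant_sequence_exact₃ _ (shortExact hf hfg hg) _ rfl h
  refine ⟨of m y, ?_⟩
  rw [map, op_of, ← of_trans hm]
  exact congrArg (of m) hy

lemma δ_map (hf : Function.Injective f) (hfg : Function.Exact f g)
    (hg : Function.Surjective g) (x : LC a i N') : δ a i hf hfg hg (map a i g x) = 0 := by
  obtain ⟨n, e, rfl⟩ := exists_of x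
  rw [map, op_of, δ, op_of, Ext.comp_assoc_of_second_deg_zero]
  have := (shortExact hf hfg hg).comp_extClass
  dsimp only at this
  rw [this, Ext.comp_zero, map_zero]

lemma map_δ (hf : Function.Injective f) (hfg : Function.Exact f g)
    (hg : Function.Surjective g) (x : LC a i N'') :
    map a (i + 1) f (δ a i hf hfg hg x) = 0 := by
  obtain ⟨n, e, rfl⟩ := exists_of x
  rw [δ, op_of, map, op_of, Ext.comp_assoc_of_third_deg_zero]
  have := (shortExact hf hfg hg).extClass_comp
  dsimp only at this
  rw [this, Ext.comp_zero, map_zero]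

lemma exact₁ (hf : Function.Injective f) (hfg : Function.Exact f g)
    (hg : Function.Surjective g) {x : LC a (i + 1) N} (hx : map a (i + 1) f x = 0) :
    ∃ y, δ a i hf hfg hg y = x := by
  obtain ⟨n, e, rfl⟩ := exists_of x
  rw [map, op_of] at hx
  obtain ⟨m, hm, h⟩ := of_eq_zero hx
  rw [← Ext.comp_assoc_of_third_deg_zero] at h
  obtain ⟨y, hy⟩ := Ext.covariant_sequence_exact₁ _ (shortExact hf hfg hg) _ h rfl
  refine ⟨of m y, ?_⟩
  rw [δ, op_of, ← of_trans hm]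
  exact congrArg (of m) hy

end Exact

/-- Evaluation at `1`, identifying `H^0` with the torsion submodule. -/
noncomputable def ev (a : Ideal R) (N : Type) [AddCommGroup N] [Module R N] : LC a 0 N →ₗ[R] N :=
  Module.DirectLimit.lift R ℕ _ _ (fun n =>
    { toFun := fun e => (Ext.linearEquiv₀ (R := R) e).hom (1 : R ⧸ a ^ n)
      map_add' := fun x y => by simp
      map_smul' := fun r x => by simp }) (fun n m h e => by
    obtain ⟨f, rfl⟩ := (Ext.linearEquiv₀ (R := R)).symm.surjective e
    simp only [Ext.linearEquiv₀_symm_apply, LinearMap.coe_mk, AddHom.coe_mk,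
      Ext.bilinearCompOfLinear_apply_apply, Ext.mk₀_comp_mk₀]
    rw [← Ext.linearEquiv₀_symm_apply (R := R), ← Ext.linearEquiv₀_symm_apply (R := R),
      LinearEquiv.apply_symm_apply, LinearEquiv.apply_symm_apply]
    rfl)

lemma ev_of_mk₀ {n : ℕ} (f : ModuleCat.of R (R ⧸ a ^ n) ⟶ ModuleCat.of R N) :
    ev a N (LCCat.of n (Ext.mk₀ f)) = f.hom (1 : R ⧸ a ^ n) := by
  rw [ev]
  refine (Module.DirectLimit.lift_of _ _ _).trans ?_
  simp only [LinearMap.coe_mk, AddHom.coe_mk]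
  rw [← Ext.linearEquiv₀_symm_apply (R := R), LinearEquiv.apply_symm_apply]

lemma exists_of_mk₀ (x : LC a 0 N) :
    ∃ n, ∃ f : ModuleCat.of R (R ⧸ a ^ n) ⟶ ModuleCat.of R N, of n (Ext.mk₀ f) = x := by
  obtain ⟨n, e, rfl⟩ := exists_of x
  obtain ⟨f, rfl⟩ := (Ext.linearEquiv₀ (R := R)).symm.surjective e
  exact ⟨n, f, rfl⟩

lemma ev_injective : Function.Injective (ev a N) := by
  rw [injective_iff_map_eq_zero]
  intro x hx
  obtain ⟨n, f, rfl⟩ := exists_of_mk₀ x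
  rw [ev_of_mk₀] at hx
  have : f = 0 := by
    ext
    exact hx
  rw [this, Ext.mk₀_zero, map_zero]

lemma ev_map (f : N →ₗ[R] N') (x : LC a 0 N) : ev a N' (map a 0 f x) = f (ev a N x) := by
  obtain ⟨n, g, rfl⟩ := exists_of_mk₀ x
  rw [map, op_of, Ext.mk₀_comp_mk₀, ev_of_mk₀, ev_of_mk₀]
  rfl

lemma exists_ev_eq {v : N} {n : ℕ} (hv : ∀ r ∈ a ^ n, r • v = 0) : ∃ x, ev a N x = v := by
  let f : ModuleCat.of R (R ⧸ a ^ n) ⟶ ModuleCat.of R N :=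
    ModuleCat.ofHom ((a ^ n).liftQ (LinearMap.toSpanSingleton R N v) hv)
  exact ⟨of n (Ext.mk₀ f), (ev_of_mk₀ f).trans (one_smul R v)⟩

/-- A module all of whose elements are killed by a power of `a`. -/
def IsPowTorsion (a : Ideal R) (N : Type) [AddCommGroup N] [Module R N] : Prop :=
  ∀ v : N, ∃ n, ∀ r ∈ a ^ n, r • v = 0

/-- The submodule of elements killed by a power of `a`. -/
def gammaSubmodule (a : Ideal R) (E : Type) [AddCommGroup E] [Module R E] : Submodule R E where
  carrier := {v | ∃ n, ∀ r ∈ a ^ n, r • v = 0}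
  add_mem' := by
    rintro v w ⟨n, hn⟩ ⟨m, hm⟩
    refine ⟨n + m, fun r hr => ?_⟩
    rw [smul_add, hn r (Ideal.pow_le_pow_right (by lia) hr),
      hm r (Ideal.pow_le_pow_right (by lia) hr), add_zero]
  zero_mem' := ⟨0, by simp⟩
  smul_mem' := by
    rintro s v ⟨n, hn⟩
    exact ⟨n, fun r hr => by rw [smul_comm, hn r hr, smul_zero]⟩

lemma gammaSubmodule_exists_pow (E : Type) [AddCommGroup E] [Module R E]
    [IsNoetherianRing R] {J : Ideal R} (f : J →ₗ[R] gammaSubmodule a E) :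
    ∃ k, ∀ r ∈ a ^ k, ∀ x : J, r • f x = 0 := by
  obtain ⟨s, hs⟩ := (Module.Finite.fg_top : (⊤ : Submodule R J).FG)
  choose k hk using fun x : J => (f x).2
  refine ⟨s.sup k, fun r hr x => ?_⟩
  have hx : x ∈ Submodule.span R (s : Set J) := hs ▸ Submodule.mem_top
  induction hx using Submodule.span_induction with
  | mem x hx =>
    exact Subtype.ext (hk x r (Ideal.pow_le_pow_right (Finset.le_sup hx) hr))
  | zero => simp
  | add x y _ _ hx hy => rw [map_add, smul_add, hx, hy, add_zero]
  | smul t x _ hx => rw [map_smul, smul_comm, hx, smul_zero]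

lemma injective_gammaSubmodule [IsNoetherianRing R] (E : Type) [AddCommGroup E] [Module R E]
    [Module.Injective R E] : Module.Injective R (gammaSubmodule a E) := by
  refine Module.Baer.injective fun J f => ?_
  obtain ⟨k, hk⟩ := gammaSubmodule_exists_pow E f
  obtain ⟨k₀, hk₀⟩ := Ideal.exists_pow_inf_eq_pow_smul a J
  let t := k₀ + k
  have ht : ∀ x : J, (x : R) ∈ a ^ t → f x = 0 := by
    intro x hx
    have h1 : (x : R) ∈ a ^ k • J := by
      have := hk₀ t (by lia)
      rw [show t - k₀ = k by lia] at this
      exact Submodule.smul_mono le_rfl inf_le_right (this.le ⟨by simpa using hx, x.2⟩)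
    have h2 : x ∈ a ^ k • (⊤ : Submodule R J) := by
      have h3 : (x : R) ∈ Submodule.map J.subtype (a ^ k • (⊤ : Submodule R J)) := by
        rwa [Submodule.map_smul'', Submodule.map_top, Submodule.range_subtype]
      obtain ⟨y, hy, hyx⟩ := h3
      rwa [← Subtype.ext hyx]
    refine Submodule.smul_induction_on (p := fun x => f x = 0) h2 (fun r hr y _ => ?_) ?_
    · exact (map_smul f r y).trans (hk r hr y)
    · intro x y hx hy
      exact (map_add f x y).trans (by rw [hx, hy, add_zero])
  let φ : J →ₗ[R] R ⧸ a ^ t := (a ^ t).mkQ ∘ₗ J.subtype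
  have hφ : ∀ x, φ x = 0 ↔ (x : R) ∈ a ^ t := fun x => Submodule.Quotient.mk_eq_zero _
  obtain ⟨h, hh⟩ := Module.Injective.out (R := R) (Q := E) ((LinearMap.ker φ).liftQ φ le_rfl)
    (LinearMap.ker_eq_bot.1 (Submodule.ker_liftQ_eq_bot' _ _ rfl))
    ((LinearMap.ker φ).liftQ ((gammaSubmodule a E).subtype ∘ₗ f) (fun x hx => by
      simp [ht x ((hφ x).1 hx)]))
  let g : R →ₗ[R] gammaSubmodule a E := LinearMap.toSpanSingleton R _ ⟨h (Submodule.Quotient.mk 1),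
    t, fun r hr => by
      have : r • (Submodule.Quotient.mk 1 : R ⧸ a ^ t) = 0 := by
        rw [← Submodule.Quotient.mk_smul, smul_eq_mul, mul_one]
        exact (Submodule.Quotient.mk_eq_zero _).2 hr
      rw [← map_smul, this, map_zero]⟩
  refine ⟨g, fun x hx => Subtype.ext ?_⟩
  have h1 : ((g x : gammaSubmodule a E) : E) = x • h (Submodule.Quotient.mk 1) := rfl
  have h2 := hh (Submodule.Quotient.mk ⟨x, hx⟩)
  have h3 : x • (Submodule.Quotient.mk 1 : R ⧸ a ^ t) = φ ⟨x, hx⟩ := by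
    rw [← Submodule.Quotient.mk_smul, smul_eq_mul, mul_one]; rfl
  rw [h1, ← map_smul, h3]
  exact h2

lemma IsPowTorsion.of_surjective {f : N →ₗ[R] N'} (hf : Function.Surjective f)
    (h : IsPowTorsion a N) : IsPowTorsion a N' := by
  intro v
  obtain ⟨w, rfl⟩ := hf v
  obtain ⟨n, hn⟩ := h w
  exact ⟨n, fun r hr => by rw [← map_smul, hn r hr, map_zero]⟩

/-- Higher local cohomology of torsion modules vanishes. -/
theorem subsingleton_of_isPowTorsion [IsNoetherianRing R] (i : ℕ) :
    ∀ (N : Type) [AddCommGroup N] [Module R N], IsPowTorsion a N → Subsingleton (LC a (i + 1) N) := by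
  induction i with
  | zero => ?_
  | succ i ih => ?_
  all_goals
    intro N _ _ hN
    obtain ⟨P⟩ := EnoughInjectives.presentation (ModuleCat.of R N)
    let E : ModuleCat R := P.J
    have hE : Injective (ModuleCat.of R E) := P.injective
    have : Module.Injective R E := Module.injective_module_of_injective_object R E
    let ι : N →ₗ[R] E := P.f.hom
    have hι : Function.Injective ι := (ModuleCat.mono_iff_injective P.f).1 P.mono
    let Γ := gammaSubmodule a E
    have hΓ : Module.Injective R Γ := injective_gammaSubmodule E
    have hΓ' : Injective (ModuleCat.of R Γ) := Module.injective_object_of_injective_module R Γ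
    let f : N →ₗ[R] Γ := ι.codRestrict Γ (fun v => by
      obtain ⟨n, hn⟩ := hN v
      exact ⟨n, fun r hr => by rw [← map_smul, hn r hr, map_zero]⟩)
    have hf : Function.Injective f := fun x y h => hι (congrArg Subtype.val h)
    let g : Γ →ₗ[R] Γ ⧸ LinearMap.range f := (LinearMap.range f).mkQ
    have hg : Function.Surjective g := Submodule.mkQ_surjective _
    have hfg : Function.Exact f g := LinearMap.exact_map_mkQ_range f
    have hΓt : IsPowTorsion a Γ := fun v => by
      obtain ⟨n, hn⟩ := v.2
      exact ⟨n, fun r hr => Subtype.ext (hn r hr)⟩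
    have hQt : IsPowTorsion a (Γ ⧸ LinearMap.range f) := hΓt.of_surjective hg
    have hLC : ∀ j, ∀ x : LC a (j + 1) Γ, x = 0 := fun j x => by
      obtain ⟨n, e, rfl⟩ := exists_of x
      rw [Ext.eq_zero_of_injective e, map_zero]
    refine subsingleton_of_forall_eq 0 fun x => ?_
    obtain ⟨y, rfl⟩ := exact₁ hf hfg hg (x := x) (hLC _ _)
  · obtain ⟨v, hv⟩ := hg (ev a _ y)
    obtain ⟨n, hn⟩ := hΓt v
    obtain ⟨w, hw⟩ := exists_ev_eq hn
    have : map a 0 g w = y := ev_injective (by rw [ev_map, hw, hv])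
    rw [← this, δ_map]
  · have := ih _ hQt
    rw [Subsingleton.elim y 0, map_zero]

end LC

end LC

section HB

variable {R B : Type} [CommRing R] [CommRing B] [Algebra R B]

/-- A module over an `R`-algebra `B`, to be viewed as an `R`-module. -/
def Res (R B N : Type) [CommRing R] [CommRing B] [Algebra R B] [AddCommGroup N] [Module B N] :
    Type := N

section Res
variable (R B) (N : Type) [AddCommGroup N] [Module B N]

instance : AddCommGroup (Res R B N) := inferInstanceAs (AddCommGroup N)

instance : Module R (Res R B N) := Module.compHom N (algebraMap R B)

end Res

/-- A linear map, viewed as linear over a ring mapping to the base ring. -/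
def restrictMap (R : Type) {B : Type} [CommRing R] [CommRing B] [Algebra R B]
    {N N' : Type} [AddCommGroup N] [Module B N] [AddCommGroup N'] [Module B N']
    (f : N →ₗ[B] N') : Res R B N →ₗ[R] Res R B N' where
  toFun := f
  map_add' := f.map_add
  map_smul' r := f.map_smul (algebraMap R B r)

/-- Local cohomology, with respect to an ideal of `R`, of a module over an `R`-algebra `B`. -/
abbrev HB (a : Ideal R) (i : ℕ) (N : Type) [AddCommGroup N] [Module B N] : Type :=
  LC a i (Res R B N)

namespace HB

variable {a : Ideal R} {i : ℕ} {N N' N'' : Type} [AddCommGroup N] [Module B N] [AddCommGroup N'] [Module B N']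
  [AddCommGroup N''] [Module B N'']

/-- Functoriality of local cohomology in `B`-linear maps. -/
noncomputable def map (a : Ideal R) (i : ℕ) (f : N →ₗ[B] N') : HB (B := B) a i N →ₗ[R] HB (B := B) a i N' :=
  LC.map a i (restrictMap R f)

lemma map_comp (f : N →ₗ[B] N') (g : N' →ₗ[B] N'') (x : HB (B := B) a i N) :
    map a i (g ∘ₗ f) x = map a i g (map a i f x) :=
  LC.map_comp (restrictMap R f) (restrictMap R g) x

lemma map_id (x : HB (B := B) a i N) : map a i (LinearMap.id : N →ₗ[B] N) x = x :=
  LC.map_id x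

lemma map_smul_id (r : R) (x : HB (B := B) a i N) :
    map a i (algebraMap R B r • LinearMap.id : N →ₗ[B] N) x = r • x :=
  LC.map_smul_id r x

lemma map_smul (r : R) (f : N →ₗ[B] N') (x : HB (B := B) a i N) :
    map a i (algebraMap R B r • f) x = r • map a i f x := by
  rw [show algebraMap R B r • f = (algebraMap R B r • LinearMap.id) ∘ₗ f from rfl, map_comp,
    map_smul_id]

lemma map_equiv_bijective (e : N ≃ₗ[B] N') : Function.Bijective (map a i e.toLinearMap) := by
  refine Function.bijective_iff_has_inverse.2 ⟨map a i e.symm.toLinearMap, fun x => ?_, fun x => ?_⟩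
  · rw [← map_comp, LinearEquiv.symm_comp, map_id]
  · rw [← map_comp, LinearEquiv.comp_symm, map_id]

lemma subsingleton_of_equiv (e : N ≃ₗ[B] N') [Subsingleton (HB (B := B) a i N)] :
    Subsingleton (HB (B := B) a i N') :=
  (map_equiv_bijective (a := a) (i := i) e).surjective.subsingleton

lemma exists_pow_smul_eq_zero (x : HB (B := B) a i N) : ∃ n, ∀ r ∈ a ^ n, r • x = 0 :=
  LC.exists_pow_smul_eq_zero x

section Exact
variable {f : N →ₗ[B] N'} {g : N' →ₗ[B] N''}

/-- The connecting homomorphism. -/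
noncomputable def δ (a : Ideal R) (i : ℕ) (hf : Function.Injective f) (hfg : Function.Exact f g)
    (hg : Function.Surjective g) : HB (B := B) a i N'' →ₗ[R] HB (B := B) a (i + 1) N :=
  LC.δ (f := restrictMap R f) (g := restrictMap R g) a i hf hfg hg

lemma exact₂ (hf : Function.Injective f) (hfg : Function.Exact f g)
    (hg : Function.Surjective g) {x : HB (B := B) a i N'} (hx : map a i g x = 0) :
    ∃ y, map a i f y = x :=
  LC.exact₂ (f := restrictMap R f) (g := restrictMap R g) hf hfg hg hx

lemma exact₃ (hf : Function.Injective f) (hfg : Function.Exact f g)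
    (hg : Function.Surjective g) {x : HB (B := B) a i N''} (hx : δ a i hf hfg hg x = 0) :
    ∃ y, map a i g y = x :=
  LC.exact₃ (f := restrictMap R f) (g := restrictMap R g) hf hfg hg hx

lemma exact₁ (hf : Function.Injective f) (hfg : Function.Exact f g)
    (hg : Function.Surjective g) {x : HB (B := B) a (i + 1) N} (hx : map a (i + 1) f x = 0) :
    ∃ y, δ a i hf hfg hg y = x :=
  LC.exact₁ (f := restrictMap R f) (g := restrictMap R g) hf hfg hg hx

lemma map_δ (hf : Function.Injective f) (hfg : Function.Exact f g)
    (hg : Function.Surjective g) (x : HB (B := B) a i N'') :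
    map a (i + 1) f (δ a i hf hfg hg x) = 0 :=
  LC.map_δ (f := restrictMap R f) (g := restrictMap R g) hf hfg hg x

end Exact

/-- A module all of whose elements are killed by a power of `a`. -/
def IsTorsion (a : Ideal R) (N : Type) [AddCommGroup N] [Module B N] : Prop :=
  ∀ v : N, ∃ n, ∀ r ∈ a ^ n, algebraMap R B r • v = 0

/-- Evaluation at `1`, identifying `H^0` with the torsion submodule. -/
noncomputable def ev (a : Ideal R) (N : Type) [AddCommGroup N] [Module B N] :
    HB (B := B) a 0 N →ₗ[R] Res R B N :=
  LC.ev a (Res R B N)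

lemma ev_injective : Function.Injective (ev (B := B) a N) := LC.ev_injective

lemma exists_ev_eq {v : N} {n : ℕ} (hv : ∀ r ∈ a ^ n, algebraMap R B r • v = 0) :
    ∃ x, ev (B := B) a N x = v :=
  LC.exists_ev_eq (N := Res R B N) hv

lemma nontrivial_zero_of_isTorsion [Nontrivial N] (h : IsTorsion (B := B) a N) :
    Nontrivial (HB (B := B) a 0 N) := by
  obtain ⟨v, hv⟩ := exists_ne (0 : N)
  obtain ⟨n, hn⟩ := h v
  obtain ⟨x, hx⟩ := exists_ev_eq hn
  refine nontrivial_of_ne x 0 fun h0 => hv ?_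
  rw [h0, map_zero] at hx
  exact hx.symm

lemma subsingleton_of_isTorsion [IsNoetherianRing R] (h : IsTorsion (B := B) a N) :
    Subsingleton (HB (B := B) a (i + 1) N) :=
  LC.subsingleton_of_isPowTorsion i (Res R B N) h

/-- Multiplication by an element of `a` which is injective on local cohomology. -/
lemma subsingleton_of_smul_injective {x : R} (hx : x ∈ a)
    (h : ∀ y : HB (B := B) a i N, x • y = 0 → y = 0) : Subsingleton (HB (B := B) a i N) := by
  refine subsingleton_of_forall_eq 0 fun y => ?_
  obtain ⟨n, hn⟩ := exists_pow_smul_eq_zero y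
  have hn : x ^ n • y = 0 := hn _ (Ideal.pow_mem_pow hx n)
  clear * - hn h
  induction n with
  | zero => simpa using hn
  | succ n ih => exact ih (h _ (by rwa [smul_smul, ← pow_succ']))

/-- Half-exactness: vanishing for the ends implies vanishing for the middle. -/
lemma subsingleton_mid {f : N →ₗ[B] N'} {g : N' →ₗ[B] N''} (hf : Function.Injective f)
    (hfg : Function.Exact f g) (hg : Function.Surjective g) [Subsingleton (HB (B := B) a i N)]
    [Subsingleton (HB (B := B) a i N'')] : Subsingleton (HB (B := B) a i N') := by
  refine subsingleton_of_forall_eq 0 fun x => ?_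
  obtain ⟨y, rfl⟩ := exact₂ hf hfg hg (x := x) (Subsingleton.elim _ _)
  rw [Subsingleton.elim y 0, map_zero]

lemma subsingleton_right {f : N →ₗ[B] N'} {g : N' →ₗ[B] N''} (hf : Function.Injective f)
    (hfg : Function.Exact f g) (hg : Function.Surjective g) [Subsingleton (HB (B := B) a i N')]
    [Subsingleton (HB (B := B) a (i + 1) N)] : Subsingleton (HB (B := B) a i N'') := by
  refine subsingleton_of_forall_eq 0 fun x => ?_
  obtain ⟨y, rfl⟩ := exact₃ hf hfg hg (x := x) (Subsingleton.elim _ _)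
  rw [Subsingleton.elim y 0, map_zero]

lemma map_surjective {f : N →ₗ[B] N'} {g : N' →ₗ[B] N''} (hf : Function.Injective f)
    (hfg : Function.Exact f g) (hg : Function.Surjective g)
    [Subsingleton (HB (B := B) a (i + 1) N)] : Function.Surjective (map a i g) :=
  fun _ => exact₃ hf hfg hg (Subsingleton.elim _ _)

lemma map_injective {f : N →ₗ[B] N'} {g : N' →ₗ[B] N''} (hf : Function.Injective f)
    (hfg : Function.Exact f g) (hg : Function.Surjective g)
    [Subsingleton (HB (B := B) a i N'')] : Function.Injective (map a (i + 1) f) := by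
  rw [injective_iff_map_eq_zero]
  intro x hx
  obtain ⟨y, rfl⟩ := exact₁ hf hfg hg hx
  rw [Subsingleton.elim y 0, map_zero]

end HB
end HB

section Devissage

open Module

variable {B : Type} [CommRing B]

/-- A prime in the support of a finite module receives a nonzero map. -/
lemma exists_ne_zero_toQuotient {N : Type} [AddCommGroup N] [Module B N] [Module.Finite B N]
    {P : PrimeSpectrum B} (hP : P ∈ support B N) : ∃ f : N →ₗ[B] B ⧸ P.asIdeal, f ≠ 0 := by
  have h0 := (Module.mem_support_iff_nontrivial_residueField_tensorProduct P).1 hP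
  let κ := P.asIdeal.ResidueField
  obtain ⟨l, hl⟩ : ∃ l : κ ⊗[B] N →ₗ[κ] κ, l ≠ 0 := by
    obtain ⟨v, hv⟩ := exists_ne (0 : κ ⊗[B] N)
    by_contra! h
    exact hv ((Module.forall_dual_apply_eq_zero_iff κ v).1 fun l => by rw [h l]; rfl)
  let h : N →ₗ[B] κ := l.restrictScalars B ∘ₗ TensorProduct.mk B κ N 1
  have hh : h ≠ 0 := by
    intro h0
    apply hl
    ext v
    exact LinearMap.congr_fun h0 v
  obtain ⟨s, hs⟩ := (Module.Finite.fg_top : (⊤ : Submodule B N).FG)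
  classical
  obtain ⟨⟨d, hd0⟩, hd⟩ := IsLocalization.exist_integer_multiples_of_finset
    (nonZeroDivisors (B ⧸ P.asIdeal)) (s.image h)
  obtain ⟨d, rfl⟩ := Ideal.Quotient.mk_surjective d
  let j : (B ⧸ P.asIdeal) →ₗ[B] κ := (Algebra.linearMap (B ⧸ P.asIdeal) κ).restrictScalars B
  have hj : Function.Injective j := IsFractionRing.injective (B ⧸ P.asIdeal) κ
  have hdj : ∀ v, d • h v ∈ LinearMap.range j := fun v => by
    have hv : v ∈ Submodule.span B (s : Set N) := hs ▸ Submodule.mem_top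
    induction hv using Submodule.span_induction with
    | mem v hv =>
      obtain ⟨w, hw⟩ := hd (h v) (Finset.mem_image_of_mem h hv)
      refine ⟨w, hw.trans ?_⟩
      change Ideal.Quotient.mk P.asIdeal d • h v = _
      rw [← Ideal.Quotient.algebraMap_eq, algebraMap_smul]
    | zero => simp
    | add x y _ _ hx hy => rw [map_add, smul_add]; exact add_mem hx hy
    | smul t x _ hx => rw [map_smul, smul_comm]; exact Submodule.smul_mem _ _ hx
  refine ⟨(LinearEquiv.ofInjective j hj).symm.toLinearMap ∘ₗ
    (d • h).codRestrict (LinearMap.range j) hdj, fun h0 => hh ?_⟩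
  ext v
  have h1 : (d • h).codRestrict (LinearMap.range j) hdj v = 0 :=
    (LinearEquiv.ofInjective j hj).symm.injective
      ((LinearMap.congr_fun h0 v).trans (map_zero _).symm)
  have h2 : d • h v = 0 := congrArg Subtype.val h1
  rw [Algebra.smul_def, mul_eq_zero] at h2
  refine h2.resolve_left fun h3 => nonZeroDivisors.ne_zero hd0 ?_
  apply hj
  rw [map_zero]
  exact (IsScalarTower.algebraMap_apply B (B ⧸ P.asIdeal) κ d).symm.trans h3

end Devissage

section HBvanish
variable {R B : Type} [CommRing R] [CommRing B] [Algebra R B] {a : Ideal R}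

open Module

namespace HB

lemma subsingleton_of_subsingleton {i : ℕ} (N : Type) [AddCommGroup N] [Module B N]
    [Subsingleton N] : Subsingleton (HB (B := B) a i N) := by
  refine subsingleton_of_forall_eq 0 fun x => ?_
  rw [← map_id x, show (LinearMap.id : N →ₗ[B] N) = algebraMap R B 0 • LinearMap.id from
    Subsingleton.elim _ _, map_smul_id, zero_smul]

/-- Vanishing of local cohomology may be tested on the primes in the support. -/
lemma subsingleton_of_support [IsNoetherianRing B] {i : ℕ} (N : Type) [AddCommGroup N] [Module B N]
    [Module.Finite B N]
    (h : ∀ Q ∈ support B N, Subsingleton (HB (B := B) a i (B ⧸ Q.asIdeal))) :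
    Subsingleton (HB (B := B) a i N) := by
  revert h
  induction ‹Module.Finite B N› using IsNoetherianRing.induction_on_isQuotientEquivQuotientPrime B with
  | subsingleton N => exact fun _ => subsingleton_of_subsingleton N
  | quotient N p e =>
    intro h
    have : Subsingleton (HB (B := B) a i (B ⧸ p.asIdeal)) := h p (by
      rw [e.support_eq, Module.support_eq_zeroLocus, Ideal.annihilator_quotient]
      exact le_refl p.asIdeal)
    exact subsingleton_of_equiv e.symm
  | exact N₁ N₂ N₃ f g hf hg hfg h₁ h₃ =>
    intro h
    have := h₁ fun Q hQ => h Q (support_subset_of_injective f hf hQ)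
    have := h₃ fun Q hQ => h Q (support_subset_of_surjective g hg hQ)
    exact subsingleton_mid hf hfg hg

section QuotSMulTop
open scoped Pointwise

variable (N : Type) [AddCommGroup N] [Module B N] (y : B)

lemma exact_lsmul_mkQ : Function.Exact (y • LinearMap.id : N →ₗ[B] N)
    (Submodule.mkQ (y • (⊤ : Submodule B N))) := by
  intro v
  rw [← LinearMap.mem_ker, Submodule.ker_mkQ, Submodule.mem_smul_pointwise_iff_exists]
  simp

lemma isTorsion_of_forall_mem (P : Ideal B) (h : ∀ x ∈ a, algebraMap R B x ∈ P) :
    IsTorsion (B := B) a (B ⧸ P) := by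
  intro v
  refine ⟨1, fun r hr => ?_⟩
  rw [pow_one] at hr
  obtain ⟨v, rfl⟩ := Ideal.Quotient.mk_surjective v
  rw [Algebra.smul_def, Ideal.Quotient.algebraMap_eq, ← map_mul]
  exact Ideal.Quotient.eq_zero_iff_mem.2 (P.mul_mem_right _ (h r hr))

end QuotSMulTop

lemma smul_injective_of_notMem {P : Ideal B} [P.IsPrime] {y : B} (hy : y ∉ P) :
    Function.Injective (y • LinearMap.id : B ⧸ P →ₗ[B] B ⧸ P) := by
  rw [injective_iff_map_eq_zero]
  intro v hv
  obtain ⟨v, rfl⟩ := Ideal.Quotient.mk_surjective v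
  have : Ideal.Quotient.mk P (y * v) = 0 := by rw [map_mul]; exact hv
  rw [Ideal.Quotient.eq_zero_iff_mem] at this ⊢
  exact (‹P.IsPrime›.mem_or_mem this).resolve_left hy

lemma support_quotient_eq (P : Ideal B) : support B (B ⧸ P) = PrimeSpectrum.zeroLocus P := by
  rw [Module.support_eq_zeroLocus, Ideal.annihilator_quotient]

lemma mem_support_quotSMulTop {P : Ideal B} {y : B} {Q : PrimeSpectrum B} :
    Q ∈ support B (QuotSMulTop y (B ⧸ P)) ↔ P ≤ Q.asIdeal ∧ y ∈ Q.asIdeal := by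
  rw [Module.support_quotSMulTop, support_quotient_eq]
  simp [PrimeSpectrum.mem_zeroLocus]

lemma ringKrullDim_succ_le {P Q : Ideal B} [P.IsPrime] (h : P ≤ Q) {y : B} (hy : y ∉ P)
    (hyQ : y ∈ Q) : ringKrullDim (B ⧸ Q) + 1 ≤ ringKrullDim (B ⧸ P) :=
  ringKrullDim_succ_le_of_surjective (Ideal.Quotient.factor h) (Ideal.Quotient.factor_surjective h)
    (r := Ideal.Quotient.mk P y)
    (mem_nonZeroDivisors_of_ne_zero (by rwa [Ne, Ideal.Quotient.eq_zero_iff_mem]))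
    (by rw [Ideal.Quotient.factor_mk]; exact Ideal.Quotient.eq_zero_iff_mem.2 hyQ)

/-- Grothendieck vanishing for prime quotients. -/
theorem subsingleton_of_ringKrullDim_lt [IsNoetherianRing R] [IsNoetherianRing B] (i : ℕ) :
    ∀ P : PrimeSpectrum B, ringKrullDim (B ⧸ P.asIdeal) < i →
      Subsingleton (HB (B := B) a i (B ⧸ P.asIdeal)) := by
  induction i with
  | zero =>
    intro P hP
    exact absurd hP (not_lt.2 (by simpa using ringKrullDim_nonneg_of_nontrivial (R := B ⧸ P.asIdeal)))
  | succ i ih =>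
    intro P hP
    by_cases h : ∀ x ∈ a, algebraMap R B x ∈ P.asIdeal
    · exact subsingleton_of_isTorsion (isTorsion_of_forall_mem _ h)
    push Not at h
    obtain ⟨x, hx, hxP⟩ := h
    have hf := smul_injective_of_notMem hxP
    have : Subsingleton (HB (B := B) a i (QuotSMulTop (algebraMap R B x) (B ⧸ P.asIdeal))) := by
      refine subsingleton_of_support _ fun Q hQ => ih Q ?_
      rw [mem_support_quotSMulTop] at hQ
      have h1 := (ringKrullDim_succ_le hQ.1 hxP hQ.2).trans_lt hP
      rw [Nat.cast_succ] at h1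
      exact lt_of_add_lt_add_right h1
    refine subsingleton_of_smul_injective hx fun y hy => ?_
    rw [← map_smul_id] at hy
    refine (injective_iff_map_eq_zero _).1 (map_injective (a := a) (i := i) hf (exact_lsmul_mkQ _ _)
      (Submodule.mkQ_surjective _)) y hy

/-- Gruson's theorem, in degrees. -/
theorem subsingleton_of_mem_support [IsNoetherianRing R] [IsNoetherianRing B]
    (n : ℕ) (hn : ringKrullDim B ≤ n) (M : Type) [AddCommGroup M] [Module B M] [Module.Finite B M]
    (c : ℕ) (hM : ∀ i ≥ c, Subsingleton (HB (B := B) a i M)) :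
    ∀ k i : ℕ, c ≤ i → n + 1 ≤ i + k → ∀ P ∈ support B M,
      Subsingleton (HB (B := B) a i (B ⧸ P.asIdeal)) := by
  intro k
  induction k with
  | zero =>
    intro i _ hi P _
    refine subsingleton_of_ringKrullDim_lt i P ?_
    refine ((ringKrullDim_quotient_le _).trans hn).trans_lt ?_
    exact_mod_cast (by lia : n < i)
  | succ k ih =>
    intro i hci hi
    have h1 : ∀ (N : Type) [AddCommGroup N] [Module B N] [Module.Finite B N],
        support B N ⊆ support B M → Subsingleton (HB (B := B) a (i + 1) N) := fun N _ _ _ hN =>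
      subsingleton_of_support _ fun Q hQ => ih (i + 1) (by lia) (by lia) Q (hN hQ)
    suffices ∀ I : Ideal B, ∀ P ∈ support B M, P.asIdeal = I →
        Subsingleton (HB (B := B) a i (B ⧸ P.asIdeal)) from fun P hP => this _ P hP rfl
    intro I
    induction I using WellFoundedGT.induction with
    | _ I IH =>
    rintro P hP rfl
    obtain ⟨h, hh⟩ := exists_ne_zero_toQuotient hP
    have : Subsingleton (HB (B := B) a (i + 1) (LinearMap.ker h)) :=
      h1 _ (support_subset_of_injective _ (LinearMap.ker h).injective_subtype)
    have := hM i hci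
    have : Subsingleton (HB (B := B) a i (LinearMap.range h)) :=
      subsingleton_right (LinearMap.ker h).injective_subtype
        (g := h.rangeRestrict) (by
          rw [LinearMap.exact_iff, LinearMap.ker_rangeRestrict, Submodule.range_subtype])
        h.surjective_rangeRestrict
    have : Subsingleton (HB (B := B) a i ((B ⧸ P.asIdeal) ⧸ LinearMap.range h)) := by
      refine subsingleton_of_support _ fun Q hQ => ?_
      have hPQ : P.asIdeal ≤ Q.asIdeal := by
        have := support_subset_of_surjective _ (Submodule.mkQ_surjective _) hQ
        rwa [support_quotient_eq] at this
      refine IH Q.asIdeal (lt_of_le_of_ne hPQ fun hE => ?_) Q (mem_support_mono hPQ hP) rfl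
      obtain ⟨v, hv⟩ : ∃ v, h v ≠ 0 := by
        by_contra! h0
        exact hh (LinearMap.ext h0)
      obtain ⟨w, hw⟩ := Ideal.Quotient.mk_surjective (h v)
      have hwP : w ∉ P.asIdeal := fun h0 => hv (by rw [← hw]; exact Ideal.Quotient.eq_zero_iff_mem.2 h0)
      rw [hE] at hwP
      refine hwP (annihilator_le_of_mem_support hQ (Module.mem_annihilator.2 fun z => ?_))
      obtain ⟨z, rfl⟩ := Submodule.mkQ_surjective _ z
      obtain ⟨z, rfl⟩ := Ideal.Quotient.mk_surjective z
      rw [← _root_.map_smul, ← LinearMap.mem_ker, Submodule.ker_mkQ]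
      refine ⟨z • v, ?_⟩
      rw [_root_.map_smul, ← hw, Algebra.smul_def, Algebra.smul_def, mul_comm]
      rfl
    exact subsingleton_mid (LinearMap.range h).injective_subtype
      (g := (LinearMap.range h).mkQ) (LinearMap.exact_subtype_mkQ _) (Submodule.mkQ_surjective _)

end HB
end HBvanish

section Melkersson
variable {R T : Type} [CommRing R] [AddCommGroup T] [Module R T]

/-- The layers `x ^ k (N ∩ (0 : x ^ (k + 1)))` of a submodule, inside the kernel of `x`. -/
private def layer (x : R) (N : Submodule R T) (k : ℕ) :
    Submodule R (LinearMap.ker (LinearMap.lsmul R T x)) where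
  carrier := {v | ∃ w ∈ N, x ^ (k + 1) • w = 0 ∧ x ^ k • w = v}
  zero_mem' := ⟨0, by simp⟩
  add_mem' := by
    rintro v v' ⟨w, h1, h2, h3⟩ ⟨w', h1', h2', h3'⟩
    exact ⟨w + w', add_mem h1 h1', by rw [smul_add, h2, h2', add_zero],
      by rw [smul_add, h3, h3']; rfl⟩
  smul_mem' := by
    rintro r v ⟨w, h1, h2, h3⟩
    exact ⟨r • w, N.smul_mem r h1, by rw [smul_comm, h2, smul_zero], by rw [smul_comm, h3]; rfl⟩

private lemma layer_mono (x : R) {N N' : Submodule R T} (h : N ≤ N') (k : ℕ) :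
    layer x N k ≤ layer x N' k := by
  rintro v ⟨w, h1, h2⟩
  exact ⟨w, h h1, h2⟩

private lemma layer_anti (x : R) (N : Submodule R T) : Antitone (layer x N) := by
  refine antitone_nat_of_succ_le fun k => ?_
  rintro v ⟨w, h1, h2, h3⟩
  exact ⟨x • w, N.smul_mem x h1, by rwa [smul_smul, ← pow_succ],
    by rwa [smul_smul, ← pow_succ]⟩

private lemma le_of_layer_eq {x : R} {N N' : Submodule R T} (hle : N ≤ N')
    (htors : ∀ t : T, ∃ n, x ^ n • t = 0) (h : ∀ k, layer x N' k ≤ layer x N k) : N' ≤ N := by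
  have : ∀ n, ∀ v ∈ N', x ^ n • v = 0 → v ∈ N := by
    intro n
    induction n with
    | zero => intro v _ h; rw [pow_zero, one_smul] at h; rw [h]; exact zero_mem _
    | succ n ih =>
      intro v hv hv0
      obtain ⟨w, hw, _, hw2⟩ := h n (show (⟨x ^ n • v, by
        rwa [LinearMap.mem_ker, LinearMap.lsmul_apply, smul_smul, ← pow_succ']⟩ :
        LinearMap.ker (LinearMap.lsmul R T x)) ∈ layer x N' n from ⟨v, hv, hv0, rfl⟩)
      have := ih (v - w) (sub_mem hv (hle hw)) (by rw [smul_sub, hw2, sub_self])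
      simpa using add_mem this hw
  intro v hv
  obtain ⟨n, hn⟩ := htors v
  exact this n v hv hn

/-- Melkersson's criterion for a principal ideal. -/
theorem isArtinian_of_isArtinian_ker (x : R) (htors : ∀ t : T, ∃ n, x ^ n • t = 0)
    [IsArtinian R (LinearMap.ker (LinearMap.lsmul R T x))] : IsArtinian R T := by
  rw [← monotone_stabilizes_iff_artinian]
  intro f
  let N : ℕ → Submodule R T := fun n => OrderDual.ofDual (f n)
  have hN : Antitone N := fun i j h => f.monotone h
  have stab : ∀ g : ℕ → Submodule R (LinearMap.ker (LinearMap.lsmul R T x)), Antitone g →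
      ∃ n, ∀ m, n ≤ m → g n = g m := fun g hg =>
    monotone_stabilizes_iff_artinian.2 ‹_› ⟨fun n => OrderDual.toDual (g n), fun i j h => hg h⟩
  have anti : ∀ {n m k l}, n ≤ m → k ≤ l → layer x (N m) l ≤ layer x (N n) k := fun h h' =>
    (layer_mono x (hN h) _).trans (layer_anti x _ h')
  obtain ⟨k₀, hk₀⟩ := stab (fun n => layer x (N n) n) fun i j h => anti h h
  choose m hm using fun k => stab (fun n => layer x (N n) k) fun i j h => anti h le_rfl
  let n₀ := max k₀ ((Finset.range k₀).sup m)
  refine ⟨n₀, fun n hn => ?_⟩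
  refine le_antisymm (α := Submodule R T) ?_ (hN hn)
  refine le_of_layer_eq (hN hn) htors fun k => ?_
  have hkn : k₀ ≤ n₀ := le_max_left _ _
  rcases lt_or_ge k k₀ with hk | hk
  · have h1 : m k ≤ n₀ := (Finset.le_sup (Finset.mem_range.2 hk)).trans (le_max_right _ _)
    exact ((hm k n₀ h1).symm.trans (hm k n (h1.trans hn))).le
  · have h1 := hk₀ (max k n) (hkn.trans (hn.trans (le_max_right _ _)))
    exact (anti hkn hk).trans (h1.le.trans (anti (le_max_right _ _) (le_max_left _ _)))

end Melkersson

section Artinian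
variable {R B : Type} [CommRing R] [CommRing B] [Algebra R B] {a : Ideal R}

open Module

namespace HB

lemma isArtinian_mid {i : ℕ} {N N' N'' : Type} [AddCommGroup N] [Module B N] [AddCommGroup N']
    [Module B N'] [AddCommGroup N''] [Module B N''] {f : N →ₗ[B] N'} {g : N' →ₗ[B] N''}
    (hf : Function.Injective f) (hfg : Function.Exact f g) (hg : Function.Surjective g)
    [IsArtinian R (HB (B := B) a i N)] [IsArtinian R (HB (B := B) a i N'')] :
    IsArtinian R (HB (B := B) a i N') := by
  refine isArtinian_of_range_eq_ker (map a i f) (map a i g) (le_antisymm ?_ fun x hx => ?_)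
  · rintro _ ⟨y, rfl⟩
    rw [LinearMap.mem_ker, ← map_comp, hfg.linearMap_comp_eq_zero,
      show (0 : N →ₗ[B] N'') = algebraMap R B 0 • 0 by simp, map_smul, zero_smul]
  · exact exact₂ hf hfg hg hx

lemma isArtinian_of_support [IsNoetherianRing B] {i : ℕ} (N : Type) [AddCommGroup N] [Module B N]
    [Module.Finite B N]
    (h : ∀ Q ∈ support B N, IsArtinian R (HB (B := B) a i (B ⧸ Q.asIdeal))) :
    IsArtinian R (HB (B := B) a i N) := by
  revert h
  induction ‹Module.Finite B N› using IsNoetherianRing.induction_on_isQuotientEquivQuotientPrime B with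
  | subsingleton N =>
    intro _
    have := subsingleton_of_subsingleton (R := R) (a := a) (i := i) (B := B) N
    infer_instance
  | quotient N p e =>
    intro h
    have : IsArtinian R (HB (B := B) a i (B ⧸ p.asIdeal)) := h p (by
      rw [e.support_eq, Module.support_eq_zeroLocus, Ideal.annihilator_quotient]
      exact le_refl p.asIdeal)
    exact isArtinian_of_surjective _ _ (map_equiv_bijective e.symm).surjective
  | exact N₁ N₂ N₃ f g hf hg hfg h₁ h₃ =>
    intro h
    have := h₁ fun Q hQ => h Q (support_subset_of_injective f hf hQ)
    have := h₃ fun Q hQ => h Q (support_subset_of_surjective g hg hQ)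
    exact isArtinian_mid hf hfg hg

lemma subsingleton_zero_of_notMem {P : Ideal B} [P.IsPrime] {x : R} (hx : x ∈ a)
    (hxP : algebraMap R B x ∉ P) : Subsingleton (HB (B := B) a 0 (B ⧸ P)) := by
  refine subsingleton_of_smul_injective hx fun y hy => ev_injective ?_
  have h1 := congrArg (ev (B := B) a (B ⧸ P)) hy
  rw [_root_.map_smul, map_zero] at h1
  rw [map_zero]
  exact (injective_iff_map_eq_zero _).1 (smul_injective_of_notMem hxP) _ h1

variable [IsLocalRing B]

/-- Local cohomology of the residue field is Artinian. -/
lemma isArtinian_residue (hκ : ∀ b : B, ∃ r : R, b - algebraMap R B r ∈ IsLocalRing.maximalIdeal B) :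
    IsArtinian R (HB (B := B) a 0 (B ⧸ IsLocalRing.maximalIdeal B)) := by
  have : IsSimpleModule R (Res R B (B ⧸ IsLocalRing.maximalIdeal B)) := by
    rw [isSimpleModule_iff_toSpanSingleton_surjective]
    refine ⟨inferInstanceAs (Nontrivial (B ⧸ IsLocalRing.maximalIdeal B)), fun v hv w => ?_⟩
    obtain ⟨v, rfl⟩ := Ideal.Quotient.mk_surjective (I := IsLocalRing.maximalIdeal B) v
    obtain ⟨w, rfl⟩ := Ideal.Quotient.mk_surjective (I := IsLocalRing.maximalIdeal B) w
    have hv : IsUnit v := by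
      by_contra h
      exact hv (Ideal.Quotient.eq_zero_iff_mem.2 h)
    obtain ⟨u, rfl⟩ := hv
    obtain ⟨r, hr⟩ := hκ (w * ↑u⁻¹)
    refine ⟨r, ?_⟩
    change algebraMap R B r • Ideal.Quotient.mk (IsLocalRing.maximalIdeal B) (u : B) = _
    rw [Algebra.smul_def, Ideal.Quotient.algebraMap_eq, ← map_mul]
    refine (Ideal.Quotient.eq.2 ?_).symm
    have := Ideal.mul_mem_right (u : B) _ hr
    rwa [sub_mul, mul_assoc, Units.inv_mul, mul_one] at this
  exact isArtinian_of_injective (ev a (B ⧸ IsLocalRing.maximalIdeal B)) ev_injective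

/-- Local cohomology of prime quotients is Artinian, if `a` is primary to the maximal ideal. -/
theorem isArtinian_quotient [IsNoetherianRing R] [IsNoetherianRing B]
    (hκ : ∀ b : B, ∃ r : R, b - algebraMap R B r ∈ IsLocalRing.maximalIdeal B)
    (P₀ : Ideal B) (hP₀ : ∀ Q : PrimeSpectrum B, P₀ ≤ Q.asIdeal →
      (∀ x ∈ a, algebraMap R B x ∈ Q.asIdeal) → Q.asIdeal = IsLocalRing.maximalIdeal B) (i : ℕ) :
    ∀ P : PrimeSpectrum B, P₀ ≤ P.asIdeal → IsArtinian R (HB (B := B) a i (B ⧸ P.asIdeal)) := by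
  induction i with
  | zero =>
    intro P hP
    by_cases h : ∀ x ∈ a, algebraMap R B x ∈ P.asIdeal
    · rw [hP₀ P hP h]
      exact isArtinian_residue hκ
    · push Not at h
      obtain ⟨x, hx, hxP⟩ := h
      have := subsingleton_zero_of_notMem hx hxP
      infer_instance
  | succ i ih =>
    intro P hP
    by_cases h : ∀ x ∈ a, algebraMap R B x ∈ P.asIdeal
    · have : Subsingleton (HB (B := B) a (i + 1) (B ⧸ P.asIdeal)) :=
        subsingleton_of_isTorsion (isTorsion_of_forall_mem _ h)
      infer_instance
    push Not at h
    obtain ⟨x, hx, hxP⟩ := h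
    have hf := smul_injective_of_notMem hxP
    have : IsArtinian R (HB (B := B) a i (QuotSMulTop (algebraMap R B x) (B ⧸ P.asIdeal))) :=
      isArtinian_of_support _ fun Q hQ => ih Q (hP.trans (mem_support_quotSMulTop.1 hQ).1)
    let d := δ a i hf (exact_lsmul_mkQ _ (algebraMap R B x)) (Submodule.mkQ_surjective _)
    have hd : ∀ y, x • d y = 0 := fun y => by
      rw [← map_smul_id]
      exact map_δ hf (exact_lsmul_mkQ _ (algebraMap R B x)) (Submodule.mkQ_surjective _) y
    have : IsArtinian R (LinearMap.ker (LinearMap.lsmul R (HB (B := B) a (i + 1) (B ⧸ P.asIdeal)) x)) := by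
      refine isArtinian_of_surjective _ (d.codRestrict _ hd) ?_
      rintro ⟨y, hy⟩
      rw [LinearMap.mem_ker, LinearMap.lsmul_apply, ← map_smul_id] at hy
      obtain ⟨z, hz⟩ := exact₁ hf (exact_lsmul_mkQ _ (algebraMap R B x)) (Submodule.mkQ_surjective _) hy
      exact ⟨z, Subtype.ext hz⟩
    refine isArtinian_of_isArtinian_ker x fun t => ?_
    obtain ⟨n, hn⟩ := exists_pow_smul_eq_zero t
    exact ⟨n, hn _ (Ideal.pow_mem_pow hx n)⟩

end HB
end Artinian

section NonVanishing
open Module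

lemma WithBot.le_natCast_of_add_one_le {x : WithBot ℕ∞} {n : ℕ}
    (h : x + 1 ≤ (n : WithBot ℕ∞) + 1) : x ≤ n := by
  cases x with
  | bot => exact bot_le
  | coe x =>
    cases x with
    | top => exact absurd h (by
        rw [not_le]
        exact WithBot.coe_lt_coe.2 (by
          change ((n : ℕ∞) + 1) < ⊤ + 1
          rw [top_add]
          exact_mod_cast ENat.natCast_lt_top (n + 1)))
    | coe m => exact_mod_cast Nat.le_of_add_le_add_right (by exact_mod_cast h : m + 1 ≤ n + 1)

lemma WithBot.natCast_le_of_add_one_le {x : WithBot ℕ∞} {n : ℕ}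
    (h : (n : WithBot ℕ∞) + 1 ≤ x + 1) : (n : WithBot ℕ∞) ≤ x := by
  cases x with
  | bot => exact absurd h (by
      rw [not_le, WithBot.bot_add]
      exact WithBot.bot_lt_coe ((n : ℕ∞) + 1))
  | coe x =>
    cases x with
    | top => exact WithBot.coe_le_coe.2 le_top
    | coe m => exact_mod_cast Nat.le_of_add_le_add_right (by exact_mod_cast h : n + 1 ≤ m + 1)

/-- A quotient ring of dimension at least `n` has a prime quotient of dimension at least `n`. -/
lemma exists_prime_le_ringKrullDim {B : Type} [CommRing B] (I : Ideal B) (n : ℕ)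
    (h : (n : WithBot ℕ∞) ≤ ringKrullDim (B ⧸ I)) :
    ∃ Q : PrimeSpectrum B, I ≤ Q.asIdeal ∧ (n : WithBot ℕ∞) ≤ ringKrullDim (B ⧸ Q.asIdeal) := by
  rw [ringKrullDim_quotient, Order.le_krullDim_iff] at h
  obtain ⟨l, hl⟩ := h
  refine ⟨l.head.1, l.head.2, ?_⟩
  rw [ringKrullDim_quotient, Order.le_krullDim_iff]
  refine ⟨⟨l.length, fun i => ⟨(l i).1, l.monotone (Fin.zero_le i)⟩, fun i => l.step i⟩, hl⟩

variable {R B : Type} [CommRing R] [CommRing B] [Algebra R B] {a : Ideal R}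

namespace HB

lemma subsingleton_of_surjective {N N' : Type} [AddCommGroup N] [Module B N] [AddCommGroup N']
    [Module B N'] {φ : N →ₗ[B] N'} (hφ : Function.Surjective φ) {i : ℕ}
    (h : Subsingleton (HB (B := B) a i N))
    (h' : Subsingleton (HB (B := B) a (i + 1) (LinearMap.ker φ))) :
    Subsingleton (HB (B := B) a i N') :=
  subsingleton_right (LinearMap.ker φ).injective_subtype (LinearMap.exact_subtype_ker_map φ) hφ

/-- Gruson's theorem: vanishing of local cohomology in high degrees is inherited by modules with
smaller support. -/
theorem subsingleton_of_support_subset [IsNoetherianRing R] [IsNoetherianRing B]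
    [IsLocalRing B] {M : Type} [AddCommGroup M] [Module B M] [Module.Finite B M]
    {c : ℕ} (hM : ∀ i ≥ c, Subsingleton (HB (B := B) a i M))
    {N : Type} [AddCommGroup N] [Module B N] [Module.Finite B N]
    (hN : support B N ⊆ support B M) {i : ℕ} (hi : c ≤ i) :
    Subsingleton (HB (B := B) a i N) := by
  refine subsingleton_of_support N fun Q hQ => ?_
  exact subsingleton_of_mem_support _ (Order.krullDim_eq_length_of_finiteDimensionalOrder).le M c hM
    ((LTSeries.longestOf (PrimeSpectrum B)).length + 1) i hi (by lia) Q (hN hQ)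

/-- Grothendieck vanishing. -/
theorem subsingleton_of_dim_lt [IsNoetherianRing R] [IsNoetherianRing B] {i : ℕ}
    (N : Type) [AddCommGroup N] [Module B N] [Module.Finite B N]
    (h : ∀ Q ∈ support B N, ringKrullDim (B ⧸ Q.asIdeal) < i) :
    Subsingleton (HB (B := B) a i N) :=
  subsingleton_of_support N fun Q hQ => subsingleton_of_ringKrullDim_lt i Q (h Q hQ)

variable [IsLocalRing B]

open IsLocalRing

lemma ringKrullDim_quotient_maximalIdeal : ringKrullDim (B ⧸ maximalIdeal B) = 0 :=
  ringKrullDim_eq_zero_of_field (ResidueField B)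

lemma eq_maximalIdeal_of_ringKrullDim_zero {P : Ideal B} [P.IsPrime]
    (h : ringKrullDim (B ⧸ P) ≤ 0) : P = maximalIdeal B := by
  by_contra hne
  have hle : P ≤ maximalIdeal B := le_maximalIdeal (Ideal.IsPrime.ne_top ‹_›)
  obtain ⟨y, hy, hyP⟩ := SetLike.exists_of_lt (lt_of_le_of_ne hle hne)
  have h1 := (ringKrullDim_succ_le hle hyP hy).trans h
  have h2 := ringKrullDim_nonneg_of_nontrivial (R := B ⧸ maximalIdeal B)
  have h3 : (0 : WithBot ℕ∞) + 1 ≤ 0 := (add_le_add_left h2 1).trans h1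
  exact absurd h3 (by decide)

variable [IsNoetherianRing R] [IsNoetherianRing B]

/-- Nonvanishing in degree one. -/
lemma not_subsingleton_one (ha : ∀ x ∈ a, algebraMap R B x ∈ maximalIdeal B)
    {P : Ideal B} [P.IsPrime] (hd : ringKrullDim (B ⧸ P) ≤ 1)
    {x : R} (hx : x ∈ a) (hxP : algebraMap R B x ∉ P) :
    ¬ Subsingleton (HB (B := B) a 1 (B ⧸ P)) := by
  intro h0
  have hle : P ≤ maximalIdeal B := le_maximalIdeal (Ideal.IsPrime.ne_top ‹_›)
  let X := QuotSMulTop (algebraMap R B x) (B ⧸ P)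
  have hX : Nontrivial X := by
    rw [← nonempty_support_iff (R := B)]
    exact ⟨⟨maximalIdeal B, inferInstance⟩, mem_support_quotSMulTop.2 ⟨hle, ha x hx⟩⟩
  obtain ⟨Q, hQ⟩ := associatedPrimes.nonempty B X
  obtain ⟨hQP, v, hv⟩ := isAssociatedPrime_iff.1 hQ
  have hQv : ∀ b, b ∈ Q ↔ b • v = 0 := fun b => by
    rw [hv, Submodule.mem_colon_singleton, Submodule.mem_bot]
  have hQX : (⟨Q, hQP⟩ : PrimeSpectrum B) ∈ support B X :=
    mem_support_iff_exists_annihilator.2 ⟨v, fun b hb => (hQv b).2 (by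
      simpa [Submodule.mem_annihilator_span_singleton] using hb)⟩
  obtain ⟨hPQ, hxQ⟩ := mem_support_quotSMulTop.1 hQX
  have hQm : Q = maximalIdeal B := eq_maximalIdeal_of_ringKrullDim_zero (by
    have h1 := (ringKrullDim_succ_le hPQ hxP hxQ).trans hd
    exact WithBot.le_natCast_of_add_one_le (n := 0) (by rwa [Nat.cast_zero, zero_add]))
  have hv0 : v ≠ 0 := fun h => hQP.one_notMem ((hQv 1).2 (by rw [h, smul_zero]))
  obtain ⟨z, hz⟩ := exists_ev_eq (a := a) (v := v) (n := 1) fun r hr => by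
    rw [← hQv, hQm]
    exact ha r (by rwa [pow_one] at hr)
  have := subsingleton_zero_of_notMem hx hxP
  have : Subsingleton (HB (B := B) a 0 X) := subsingleton_right (smul_injective_of_notMem hxP)
    (exact_lsmul_mkQ _ (algebraMap R B x)) (Submodule.mkQ_surjective _)
  rw [Subsingleton.elim z 0, map_zero] at hz
  exact hv0 hz.symm

lemma exists_mem_forall_smul {T : Type} [AddCommGroup T] [Module R T] [IsArtinian R T]
    {P : Ideal B} [P.IsPrime] (hP : ∃ x ∈ a, algebraMap R B x ∉ P) :
    ∃ y₀ ∈ a, algebraMap R B y₀ ∉ P ∧ ∀ y, algebraMap R B y ∉ P → ∀ t : T, ∃ t' : T,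
      y₀ • t = y • t' := by
  obtain ⟨_, ⟨y₀, ⟨h1, h2⟩, rfl⟩, hmin⟩ := IsArtinian.set_has_minimal
    ((fun x => LinearMap.range (LinearMap.lsmul R T x)) '' {x | x ∈ a ∧ algebraMap R B x ∉ P})
    (Set.Nonempty.image _ hP)
  refine ⟨y₀, h1, h2, fun y hy t => ?_⟩
  have hle : LinearMap.range (LinearMap.lsmul R T (y * y₀)) ≤
      LinearMap.range (LinearMap.lsmul R T y₀) := by
    rintro _ ⟨t, rfl⟩
    exact ⟨y • t, by simp [mul_smul, smul_comm y]⟩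
  have heq := eq_of_le_of_not_lt hle (hmin _ ⟨y * y₀, ⟨a.mul_mem_left _ h1, by
    rw [map_mul]
    exact fun h => (Ideal.IsPrime.mem_or_mem ‹_› h).elim hy h2⟩, rfl⟩)
  obtain ⟨t', ht'⟩ := heq.ge ⟨t, rfl⟩
  exact ⟨y₀ • t', by simpa [mul_smul] using ht'.symm⟩

/-- Prime avoidance for the elements used to cut down the dimension. -/
lemma exists_mem_notMem_minimalPrimes (P : Ideal B) [P.IsPrime]
    (hP : ∀ Q : PrimeSpectrum B, P ≤ Q.asIdeal →
      (∀ x ∈ a, algebraMap R B x ∈ Q.asIdeal) → Q.asIdeal = maximalIdeal B)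
    (hPm : P ≠ maximalIdeal B) (I : Ideal B) (hI : P ≤ I) :
    ∃ y ∈ a, algebraMap R B y ∉ P ∧
      ∀ Q ∈ I.minimalPrimes, algebraMap R B y ∈ Q → Q = maximalIdeal B := by
  classical
  have hfin := (Ideal.finite_minimalPrimes_of_isNoetherianRing B I).subset
    (Set.sep_subset I.minimalPrimes (fun Q => Q ≠ maximalIdeal B))
  let s := insert P hfin.toFinset
  have hs : ∀ Q ∈ s, Q.IsPrime ∧ P ≤ Q ∧ Q ≠ maximalIdeal B := by
    intro Q hQ
    rcases Finset.mem_insert.1 hQ with rfl | hQ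
    · exact ⟨‹_›, le_rfl, hPm⟩
    · obtain ⟨h1, h2⟩ := hfin.mem_toFinset.1 hQ
      exact ⟨h1.1.1, hI.trans h1.1.2, h2⟩
  have h1 : ¬ ((a : Set R) ⊆ ⋃ Q ∈ (s : Set (Ideal B)), ((Q.comap (algebraMap R B) : Ideal R) : Set R)) := by
    rw [Ideal.subset_union_prime P P fun Q hQ _ _ => (hs Q hQ).1.comap _]
    rintro ⟨Q, hQ, haQ⟩
    obtain ⟨h1, h2, h3⟩ := hs Q hQ
    exact h3 (hP ⟨Q, h1⟩ h2 fun x hx => haQ hx)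
  obtain ⟨y, hy, hy'⟩ := Set.not_subset.1 h1
  simp only [Set.mem_iUnion, not_exists] at hy'
  refine ⟨y, hy, hy' P (by simp [s]), fun Q hQ hyQ => ?_⟩
  by_contra hne
  exact hy' Q (Finset.mem_coe.2 (Finset.mem_insert_of_mem (hfin.mem_toFinset.2 ⟨hQ, hne⟩))) hyQ

/-- Cutting down by a parameter. -/
lemma exists_prime_of_parameter {P : Ideal B} [P.IsPrime] {y : B} (hy : y ∉ P)
    (hym : y ∈ maximalIdeal B) {d : ℕ} (hd : ringKrullDim (B ⧸ P) = (d + 1 : ℕ)) :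
    ∃ Q : PrimeSpectrum B, P ≤ Q.asIdeal ∧ y ∈ Q.asIdeal ∧ ringKrullDim (B ⧸ Q.asIdeal) = d := by
  have hloc : IsLocalRing (B ⧸ P) := .of_surjective' _ Ideal.Quotient.mk_surjective
  have h1 := ringKrullDim_le_ringKrullDim_quotient_add_card (R := B ⧸ P)
    {Ideal.Quotient.mk P y} (by
      rw [Finset.coe_singleton, Set.singleton_subset_iff, IsLocalRing.ringJacobson_eq_maximalIdeal]
      exact (map_maximalIdeal_of_surjective _ Ideal.Quotient.mk_surjective).le (Ideal.mem_map_of_mem _ hym))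
  rw [hd, Finset.card_singleton, Nat.cast_add] at h1
  obtain ⟨Q', hQ', hQd⟩ := exists_prime_le_ringKrullDim _ d (WithBot.natCast_le_of_add_one_le h1)
  have hyQ : Ideal.Quotient.mk P y ∈ Q'.asIdeal := hQ' (Ideal.subset_span (by simp))
  let Q : PrimeSpectrum B := Q'.comap (Ideal.Quotient.mk P)
  have hPQ : P ≤ Q.asIdeal := fun x hx => by
    change Ideal.Quotient.mk P x ∈ Q'.asIdeal
    rw [Ideal.Quotient.eq_zero_iff_mem.2 hx]
    exact zero_mem _
  refine ⟨Q, hPQ, hyQ, le_antisymm ?_ (hQd.trans ?_)⟩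
  · have := (ringKrullDim_succ_le hPQ hy hyQ).trans hd.le
    rw [Nat.cast_add] at this
    exact WithBot.le_natCast_of_add_one_le this
  · exact ringKrullDim_le_of_surjective
      (Ideal.Quotient.lift Q.asIdeal ((Ideal.Quotient.mk Q'.asIdeal).comp (Ideal.Quotient.mk P))
        fun x hx => Ideal.Quotient.eq_zero_iff_mem.2 hx)
      (Ideal.Quotient.lift_surjective_of_surjective _ _
        (Ideal.Quotient.mk_surjective.comp Ideal.Quotient.mk_surjective))

lemma exists_quotSMulTop_surjective {P Q : Ideal B} (h : P ≤ Q) {y : B} (hy : y ∈ Q) :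
    ∃ φ : QuotSMulTop y (B ⧸ P) →ₗ[B] B ⧸ Q, Function.Surjective φ := by
  refine ⟨Submodule.liftQ _ (Submodule.factor h : (B ⧸ P) →ₗ[B] B ⧸ Q) ?_, fun z => ?_⟩
  · rintro _ ⟨v, _, rfl⟩
    obtain ⟨v, rfl⟩ := Submodule.mkQ_surjective _ v
    rw [LinearMap.mem_ker, DistribSMul.toLinearMap_apply, ← _root_.map_smul]
    exact (Submodule.Quotient.mk_eq_zero Q).2 (Q.mul_mem_right v hy)
  · obtain ⟨z, rfl⟩ := Submodule.mkQ_surjective _ z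
    exact ⟨Submodule.mkQ _ (Submodule.mkQ _ z), rfl⟩

set_option maxHeartbeats 1000000 in
/-- Nonvanishing of top local cohomology of prime quotients, `a` being primary to the maximal
ideal. -/
theorem not_subsingleton (ha : ∀ x ∈ a, algebraMap R B x ∈ maximalIdeal B)
    (hκ : ∀ b : B, ∃ r : R, b - algebraMap R B r ∈ maximalIdeal B)
    (P₀ : Ideal B) (hP₀ : ∀ Q : PrimeSpectrum B, P₀ ≤ Q.asIdeal →
      (∀ x ∈ a, algebraMap R B x ∈ Q.asIdeal) → Q.asIdeal = maximalIdeal B) (d : ℕ) :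
    ∀ P : PrimeSpectrum B, P₀ ≤ P.asIdeal → ringKrullDim (B ⧸ P.asIdeal) = d →
      ¬ Subsingleton (HB (B := B) a d (B ⧸ P.asIdeal)) := by
  induction d with
  | zero =>
    intro P _ hPd
    have hPm : P.asIdeal = maximalIdeal B := eq_maximalIdeal_of_ringKrullDim_zero hPd.le
    rw [not_subsingleton_iff_nontrivial]
    refine nontrivial_zero_of_isTorsion (isTorsion_of_forall_mem _ fun x hx => ?_)
    rw [hPm]
    exact ha x hx
  | succ d ih =>
    intro P hP hPd h0
    have hPm : P.asIdeal ≠ maximalIdeal B := by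
      intro h
      rw [h, ringKrullDim_quotient_maximalIdeal] at hPd
      norm_cast at hPd
    have haP : ∃ x ∈ a, algebraMap R B x ∉ P.asIdeal := by
      by_contra! h
      exact hPm (hP₀ P hP h)
    obtain ⟨x, hx, hxP⟩ := haP
    rcases Nat.eq_zero_or_pos d with rfl | hdpos
    · exact not_subsingleton_one ha hPd.le hx hxP h0
    have hvan : ∀ (N : Type) [AddCommGroup N] [Module B N] [Module.Finite B N],
        (∀ Q ∈ support B N, P.asIdeal ≤ Q.asIdeal) → Subsingleton (HB (B := B) a (d + 1) N) := by
      intro N _ _ _ hN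
      refine subsingleton_of_support_subset (M := B ⧸ P.asIdeal) (c := d + 1) (fun i hi => ?_)
        (fun Q hQ => ?_) le_rfl
      · rcases hi.eq_or_lt with rfl | hi
        · exact h0
        · exact subsingleton_of_ringKrullDim_lt i P (hPd.trans_lt (by exact_mod_cast hi))
      · rw [support_quotient_eq]
        exact hN Q hQ
    have hart := isArtinian_quotient hκ P₀ hP₀ d P hP
    obtain ⟨y₀, hy₀, hy₀P, hdiv⟩ := exists_mem_forall_smul
      (T := HB (B := B) a d (B ⧸ P.asIdeal)) ⟨x, hx, hxP⟩
    obtain ⟨y, hy, hyP, hymin⟩ := exists_mem_notMem_minimalPrimes P.asIdeal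
      (fun Q hQ => hP₀ Q (hP.trans hQ)) hPm (P.asIdeal ⊔ Ideal.span {algebraMap R B y₀}) le_sup_left
    let X := QuotSMulTop (algebraMap R B y) (B ⧸ P.asIdeal)
    have hXP : ∀ Q ∈ support B X, P.asIdeal ≤ Q.asIdeal ∧ algebraMap R B y ∈ Q.asIdeal :=
      fun Q hQ => mem_support_quotSMulTop.1 hQ
    have hTX : Function.Surjective (map a d (Submodule.mkQ _ : (B ⧸ P.asIdeal) →ₗ[B] X)) := by
      have := hvan (B ⧸ P.asIdeal) fun Q hQ => by rwa [support_quotient_eq] at hQ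
      exact map_surjective (smul_injective_of_notMem hyP)
        (exact_lsmul_mkQ _ (algebraMap R B y)) (Submodule.mkQ_surjective _)
    let m₀ : X →ₗ[B] X := algebraMap R B y₀ • LinearMap.id
    have hZ : Subsingleton (HB (B := B) a d (X ⧸ LinearMap.range m₀)) := by
      refine subsingleton_of_dim_lt _ fun Q hQ => ?_
      obtain ⟨hPQ, hyQ⟩ := hXP Q (support_subset_of_surjective _ (Submodule.mkQ_surjective _) hQ)
      have hy₀Q : algebraMap R B y₀ ∈ Q.asIdeal :=
        annihilator_le_of_mem_support hQ (Module.mem_annihilator.2 fun z => by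
          obtain ⟨z, rfl⟩ := Submodule.mkQ_surjective _ z
          rw [← _root_.map_smul, ← LinearMap.mem_ker, Submodule.ker_mkQ]
          exact ⟨z, rfl⟩)
      obtain ⟨Q', hQ', hQQ'⟩ := Ideal.exists_minimalPrimes_le
        (I := P.asIdeal ⊔ Ideal.span {algebraMap R B y₀}) (J := Q.asIdeal)
        (sup_le hPQ (by rwa [Ideal.span_singleton_le_iff_mem]))
      have hQ'p : Q'.IsPrime := hQ'.1.1
      by_cases hyQ' : algebraMap R B y ∈ Q'
      · have hQm : Q.asIdeal = maximalIdeal B :=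
          le_antisymm (le_maximalIdeal Q.2.ne_top) (hymin Q' hQ' hyQ' ▸ hQQ')
        rw [hQm, ringKrullDim_quotient_maximalIdeal]
        exact_mod_cast hdpos
      · have h1 := ringKrullDim_succ_le hQQ' hyQ' hyQ
        have h2 := (ringKrullDim_succ_le (le_sup_left.trans hQ'.1.2) hy₀P
          (hQ'.1.2 (Ideal.mem_sup_right (Ideal.mem_span_singleton_self _)))).trans hPd.le
        rw [Nat.cast_add] at h2
        have h3 := h1.trans (WithBot.le_natCast_of_add_one_le h2)
        refine lt_of_not_ge fun h4 => ?_
        have h5 : ((d + 1 : ℕ) : WithBot ℕ∞) ≤ d := by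
          rw [Nat.cast_add]
          exact (add_le_add_left h4 1).trans h3
        exact absurd (by exact_mod_cast h5 : d + 1 ≤ d) (by lia)
    have hsur : ∀ t : HB (B := B) a d X, ∃ t', y₀ • t' = t := by
      have : Subsingleton (HB (B := B) a (d + 1) (LinearMap.ker m₀)) := hvan _ fun Q hQ =>
        (hXP Q (support_subset_of_injective _ (LinearMap.ker m₀).injective_subtype hQ)).1
      have h1 : Function.Surjective (map a d m₀.rangeRestrict) :=
        map_surjective (LinearMap.ker m₀).injective_subtype
          (by rw [LinearMap.exact_iff, LinearMap.ker_rangeRestrict, Submodule.range_subtype])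
          m₀.surjective_rangeRestrict
      intro t
      obtain ⟨s, rfl⟩ := exact₂ (LinearMap.range m₀).injective_subtype
        (g := (LinearMap.range m₀).mkQ) (LinearMap.exact_subtype_mkQ _)
        (Submodule.mkQ_surjective _) (x := t) (Subsingleton.elim _ _)
      obtain ⟨s, rfl⟩ := h1 s
      refine ⟨s, ?_⟩
      rw [← map_comp, ← map_smul_id]
      rfl
    have hX0 : ∀ t : HB (B := B) a d X, t = 0 := by
      intro t
      obtain ⟨t', rfl⟩ := hsur t
      obtain ⟨s, rfl⟩ := hTX t'
      obtain ⟨s', hs'⟩ := hdiv y hyP s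
      rw [← _root_.map_smul, hs', ← map_smul_id, ← map_comp,
        (exact_lsmul_mkQ _ (algebraMap R B y)).linearMap_comp_eq_zero,
        show (0 : (B ⧸ P.asIdeal) →ₗ[B] X) = algebraMap R B 0 • 0 by simp, map_smul, zero_smul]
    obtain ⟨Q, hPQ, hyQ, hQd⟩ := exists_prime_of_parameter hyP (ha y hy) hPd
    refine ih Q (hP.trans hPQ) hQd ?_
    obtain ⟨φ, hφ⟩ := exists_quotSMulTop_surjective hPQ hyQ
    exact subsingleton_of_surjective hφ (subsingleton_of_forall_eq 0 hX0) <| hvan _ fun Q hQ =>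
      (hXP Q (support_subset_of_injective _ (LinearMap.ker φ).injective_subtype hQ)).1

end HB
end NonVanishing

section Completion

/-- An adically complete algebra over a Noetherian ring is Noetherian if the ideal is finitely
generated and the residue ring is a quotient of the base. -/
theorem isNoetherianRing_of_isAdicComplete {A S : Type*} [CommRing A] [IsNoetherianRing A]
    [CommRing S] [Algebra A S] (J : Ideal S) (hJ : J.FG) [IsAdicComplete J S]
    (h : Function.Surjective ((Ideal.Quotient.mk J).comp (algebraMap A S))) :
    IsNoetherianRing S := by
  obtain ⟨n, x, hx⟩ := Submodule.fg_iff_exists_fin_generating_family.1 hJ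
  let P := MvPolynomial (Fin n) A
  let I : Ideal P := MvPolynomial.idealOfVars (Fin n) A
  let g : P →+* S := (MvPolynomial.aeval x).toRingHom
  have hg : I.map g = J := by
    change Ideal.map g (Ideal.span (Set.range MvPolynomial.X)) = J
    rw [Ideal.map_span, ← Set.range_comp, ← hx]
    congr 2
    ext i
    exact MvPolynomial.aeval_X x i
  have hgn (n : ℕ) : I ^ n ≤ (J ^ n).comap g := by
    rw [← Ideal.map_le_iff_le_comap, Ideal.map_pow, hg]
  let q (n : ℕ) : P ⧸ I ^ n →+* S ⧸ J ^ n := Ideal.quotientMap (J ^ n) g (hgn n)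
  let f (n : ℕ) : AdicCompletion I P →+* S ⧸ J ^ n := (q n).comp (AdicCompletion.evalₐ I n : _ →+* _)
  have hf : ∀ {m n : ℕ} (hle : m ≤ n), (Ideal.Quotient.factorPow J hle).comp (f n) = f m := by
    intro m n hle
    ext y
    obtain ⟨y, rfl⟩ := AdicCompletion.mk_surjective I P y
    simp only [f, q, RingHom.comp_apply, RingHom.coe_coe, AdicCompletion.evalₐ_mk,
      Ideal.quotientMap_mk]
    rw [Ideal.Quotient.factorPow, Ideal.Quotient.factor_mk, ← Ideal.quotientMap_mk (H := hgn m),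
      ← Ideal.quotientMap_mk (H := hgn m), AdicCompletion.Ideal.mk_eq_mk I hle]
  let φ := IsAdicComplete.liftRingHom J f hf
  have hφ (p : P) : φ (algebraMap P _ p) = g p := by
    rw [← sub_eq_zero]
    refine IsHausdorff.haus (I := J) inferInstance _ fun n => ?_
    rw [SModEq.zero, smul_eq_mul, Ideal.mul_top, ← Ideal.Quotient.eq_zero_iff_mem, map_sub,
      sub_eq_zero, IsAdicComplete.mk_liftRingHom]
    simp only [f, q, RingHom.comp_apply, RingHom.coe_coe, AdicCompletion.algebraMap_apply]
    erw [AdicCompletion.evalₐ_of]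
  have hIφ : (I.map (algebraMap P (AdicCompletion I P))).map φ = J := by
    rw [Ideal.map_map, ← hg]
    exact congrArg (Ideal.map · I) (RingHom.ext hφ)
  have := AdicCompletion.isAdicComplete_self I (MvPolynomial.idealOfVars_fg (Fin n) A)
  have hJ' : IsHausdorff ((I.map (algebraMap P (AdicCompletion I P))).map φ) S := by
    rw [hIφ]
    infer_instance
  have hsurj : Function.Surjective φ := by
    refine surjective_of_mk_map_comp_surjective
      (I := I.map (algebraMap P (AdicCompletion I P))) φ fun z => ?_
    obtain ⟨z, rfl⟩ := Ideal.Quotient.mk_surjective z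
    obtain ⟨y, hy⟩ := h (Ideal.Quotient.mk J z)
    refine ⟨algebraMap P _ (MvPolynomial.C y), ?_⟩
    rw [RingHom.comp_apply, hφ, Ideal.Quotient.eq, hIφ, ← Ideal.Quotient.eq, ← hy]
    exact congrArg _ (MvPolynomial.aeval_C x y)
  have : IsNoetherianRing (AdicCompletion I P) := isNoetherianRing_of_ringEquiv _
    (MvPowerSeries.toAdicCompletionAlgEquiv (Fin n) A).toRingEquiv
  exact isNoetherianRing_of_surjective _ _ φ hsurj

instance isNoetherianRing_adicCompletion {A : Type*} [CommRing A] [IsNoetherianRing A]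
    [IsLocalRing A] : IsNoetherianRing (AdicCompletion (IsLocalRing.maximalIdeal A) A) := by
  refine isNoetherianRing_of_isAdicComplete (A := A) (IsLocalRing.maximalIdeal _) ?_ fun z => ?_
  · rw [AdicCompletion.maximalIdeal_eq_map]
    exact (IsLocalRing.maximalIdeal A).fg_of_isNoetherianRing.map _
  · obtain ⟨y, hy⟩ := (AdicCompletion.residueField_map_bijective A).2 z
    obtain ⟨y, rfl⟩ := IsLocalRing.residue_surjective y
    exact ⟨y, hy⟩

end Completion

section Dimension
open IsLocalRing

/-- A prime of a local overring with the same dimension as its image downstairs forces the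
contraction of the maximal ideal to be maximal. -/
theorem isMaximal_of_ringKrullDim_eq {R B : Type} [CommRing R] [CommRing B] [Algebra R B]
    [IsNoetherianRing R] [IsNoetherianRing B] [IsLocalRing B] {p : Ideal R} [p.IsPrime]
    (hcomap : (maximalIdeal B).comap (algebraMap R B) = p)
    (hmap : p.map (algebraMap R B) = maximalIdeal B) {q : Ideal R} [q.IsPrime] {P : Ideal B}
    [P.IsPrime] (hqP : q ≤ P.comap (algebraMap R B)) {c : ℕ}
    (hq : ringKrullDim (R ⧸ q) = c) (hP : ringKrullDim (B ⧸ P) = c) : p.IsMaximal := by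
  classical
  have hPm : P ≤ maximalIdeal B := le_maximalIdeal (Ideal.IsPrime.ne_top ‹_›)
  have hqp : q ≤ p := hqP.trans ((Ideal.comap_mono hPm).trans hcomap.le)
  let p' : Ideal (R ⧸ q) := p.map (Ideal.Quotient.mk q)
  have hp' : p'.comap (Ideal.Quotient.mk q) = p := by
    rw [Ideal.comap_map_of_surjective' _ Ideal.Quotient.mk_surjective, Ideal.mk_ker,
      sup_of_le_left hqp]
  have hp'p : p'.IsPrime := Ideal.map_isPrime_of_surjective Ideal.Quotient.mk_surjective
    (by rwa [Ideal.mk_ker])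
  obtain ⟨s, hs, hcard⟩ := p'.exists_finset_card_eq_height_of_isNoetherianRing
  have hloc : IsLocalRing (B ⧸ P) := .of_surjective' _ Ideal.Quotient.mk_surjective
  have hBm : (maximalIdeal (B ⧸ P)).comap (Ideal.Quotient.mk P) = maximalIdeal B := by
    have := IsLocalHom.of_surjective (Ideal.Quotient.mk P) Ideal.Quotient.mk_surjective
    exact maximalIdeal_comap _
  let ψ : R ⧸ q →+* B ⧸ P := Ideal.quotientMap P (algebraMap R B) hqP
  have hψ : (maximalIdeal (B ⧸ P)).comap ψ = p' := by
    refine Ideal.comap_injective_of_surjective _ Ideal.Quotient.mk_surjective ?_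
    rw [hp', ← hcomap, ← hBm, Ideal.comap_comap, Ideal.comap_comap, Ideal.quotientMap_comp_mk]
  have h1 := ringKrullDim_le_ringKrullDim_quotient_add_card (R := B ⧸ P) (s.image ψ) (by
    rw [ringJacobson_eq_maximalIdeal, Finset.coe_image, Set.image_subset_iff]
    exact fun x hx => hψ.ge (hs.1.2 (Ideal.subset_span hx)))
  have h2 : ringKrullDim ((B ⧸ P) ⧸ Ideal.span (s.image ψ : Set (B ⧸ P))) ≤ 0 := by
    by_contra h
    obtain ⟨Q, hQ, hQ1⟩ := exists_prime_le_ringKrullDim _ 1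
      (by
        simpa using ENat.WithBot.add_one_le_iff (n := 0) |>.2 (not_le.1 h))
    have hQm : Q.asIdeal = maximalIdeal (B ⧸ P) := by
      refine le_antisymm (le_maximalIdeal Q.2.ne_top) ?_
      have hle : p' ≤ Q.asIdeal.comap ψ := hs.2 ⟨Ideal.IsPrime.comap ψ, Ideal.span_le.2 fun x hx =>
        hQ (Ideal.subset_span (by simpa using ⟨x, hx, rfl⟩))⟩
        (hψ ▸ Ideal.comap_mono (le_maximalIdeal Q.2.ne_top))
      rw [← Ideal.map_comap_of_surjective _ Ideal.Quotient.mk_surjective (maximalIdeal (B ⧸ P)),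
        hBm, ← hmap, Ideal.map_map, Ideal.map_le_iff_le_comap, ← Ideal.quotientMap_comp_mk hqP,
        ← Ideal.comap_comap, ← hp']
      exact Ideal.comap_mono hle
    rw [hQm, HB.ringKrullDim_quotient_maximalIdeal] at hQ1
    exact absurd hQ1 (by decide)
  have h3 : (c : WithBot ℕ∞) ≤ s.card := by
    refine (hP.ge.trans h1).trans ((add_le_add_left h2 _).trans ?_)
    rw [zero_add]
    exact_mod_cast Finset.card_image_le
  have hfin : p'.height ≠ ⊤ := by
    rw [← hcard]
    exact ENat.natCast_ne_top _
  by_contra hmax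
  obtain ⟨m, hm, hpm⟩ := Ideal.exists_le_maximal p (Ideal.IsPrime.ne_top ‹_›)
  have hlt : p < m := lt_of_le_of_ne hpm fun h => hmax (h ▸ hm)
  obtain ⟨y, hym, hyp⟩ := SetLike.exists_of_lt hlt
  let m' : Ideal (R ⧸ q) := m.map (Ideal.Quotient.mk q)
  have hm'p : m'.IsPrime := Ideal.map_isPrime_of_surjective Ideal.Quotient.mk_surjective
    (by rw [Ideal.mk_ker]; exact hqp.trans hpm)
  have hlt' : p' < m' := lt_of_le_of_ne (Ideal.map_mono hpm) fun h =>
    hyp (hp' ▸ h ▸ Ideal.mem_map_of_mem _ hym)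
  have h4 := Ideal.height_add_one_le_of_lt_of_isPrime hlt'
  have h5 := Ideal.height_le_ringKrullDim_of_ne_top hm'p.ne_top
  rw [hq] at h5
  rw [← hcard] at h4
  have h6 : ((s.card + 1 : ℕ) : WithBot ℕ∞) ≤ c := le_trans (by exact_mod_cast h4) h5
  have h7 := h6.trans h3
  exact absurd (by exact_mod_cast h7 : s.card + 1 ≤ s.card) (by lia)

end Dimension

section BaseChange
open Abelian

variable {R : Type} [CommRing R]

lemma lTensorHomToHomLTensor_lcomp {X X' F M : Type} [AddCommGroup X] [Module R X]
    [AddCommGroup X'] [Module R X'] [AddCommGroup F] [Module R F] [AddCommGroup M] [Module R M]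
    (h : X' →ₗ[R] X) (t : F ⊗[R] (X →ₗ[R] M)) :
    lTensorHomToHomLTensor (.id R) X' F M ((LinearMap.lcomp R M h).lTensor F t) =
      (lTensorHomToHomLTensor (.id R) X F M t) ∘ₗ h := by
  induction t with
  | zero => simp
  | add x y hx hy => rw [map_add, map_add, hx, hy, map_add, LinearMap.add_comp]
  | tmul f φ => ext x; simp

/-- `Hom` out of a finitely generated module commutes with flat base change; surjectivity part. -/
lemma lTensorHomToHomLTensor_surjective [IsNoetherianRing R] (X F M : Type) [AddCommGroup X]
    [Module R X] [Module.Finite R X] [AddCommGroup F] [Module R F] [Module.Flat R F]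
    [AddCommGroup M] [Module R M] :
    Function.Surjective (lTensorHomToHomLTensor (.id R) X F M) := by
  obtain ⟨N₀, _, _, _, _, g, hg⟩ := Module.exists_finite_presentation R X
  obtain ⟨N₁, _, _, _, _, h', hh'⟩ := Module.exists_finite_presentation R (LinearMap.ker g)
  let h : N₁ →ₗ[R] N₀ := (LinearMap.ker g).subtype ∘ₗ h'
  have hex : Function.Exact h g := by
    rw [LinearMap.exact_iff, LinearMap.range_comp, LinearMap.range_eq_top.2 hh', Submodule.map_top,
      Submodule.range_subtype]
  intro f
  let u := (lTensorHomEquivHomLTensor R N₀ F M).symm (f ∘ₗ g)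
  have hu : lTensorHomToHomLTensor (.id R) N₀ F M u = f ∘ₗ g := by
    rw [← lTensorHomEquivHomLTensor_apply, LinearEquiv.apply_symm_apply]
  have h0 : (LinearMap.lcomp R M h).lTensor F u = 0 := by
    apply (lTensorHomEquivHomLTensor R N₁ F M).injective
    rw [lTensorHomEquivHomLTensor_apply, lTensorHomToHomLTensor_lcomp, hu, map_zero,
      LinearMap.comp_assoc, hex.linearMap_comp_eq_zero, LinearMap.comp_zero]
  obtain ⟨v, hv⟩ := (Module.Flat.lTensor_exact F
    (LinearMap.exact_lcomp_of_exact_of_surjective M hex hg) u).1 h0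
  refine ⟨v, ?_⟩
  rw [← hv, lTensorHomToHomLTensor_lcomp] at hu
  exact (LinearMap.cancel_right hg).1 hu

/-- `Ext` into a flat base change is generated by the images of `Ext` before base change. -/
lemma ext_tensorProduct_mem_closure [IsNoetherianRing R] (F M : Type) [AddCommGroup F] [Module R F]
    [Module.Flat R F] [AddCommGroup M] [Module R M] (i : ℕ) :
    ∀ (X : ModuleCat.{0} R) [Module.Finite R X] (e : Ext X (ModuleCat.of R (F ⊗[R] M)) i),
      e ∈ AddSubgroup.closure {e | ∃ (y : Ext X (ModuleCat.of R M) i) (b : F),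
        e = y.comp (Ext.mk₀ (ModuleCat.ofHom (TensorProduct.mk R F M b))) (add_zero i)} := by
  induction i with
  | zero =>
    intro X _ e
    obtain ⟨f, rfl⟩ := (Ext.linearEquiv₀ (R := R)).symm.surjective e
    rw [Ext.linearEquiv₀_symm_apply]
    obtain ⟨t, ht⟩ := lTensorHomToHomLTensor_surjective X F M f.hom
    obtain rfl : f = ModuleCat.ofHom (lTensorHomToHomLTensor (.id R) X F M t) := by
      rw [ht]; rfl
    clear ht
    induction t with
    | zero =>
      rw [map_zero]
      convert AddSubgroup.zero_mem _
      exact Ext.mk₀_zero _ _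
    | add x y hx hy =>
      rw [map_add, ModuleCat.ofHom_add, Ext.mk₀_add]
      exact AddSubgroup.add_mem _ hx hy
    | tmul b φ =>
      refine AddSubgroup.subset_closure ⟨Ext.mk₀ (ModuleCat.ofHom φ), b, ?_⟩
      rw [Ext.mk₀_comp_mk₀]
      congr 1
  | succ n ih =>
    intro X _ e
    obtain ⟨N, _, _, _, _, f, surjf⟩ := Module.exists_finite_presentation R X
    let exac := LinearMap.shortExact_shortComplexKer surjf
    obtain ⟨e', rfl⟩ := precomp_extClass_surjective_of_projective_X₂ _ exac n e
    have := ih _ e'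
    induction this using AddSubgroup.closure_induction with
    | mem x hx =>
      obtain ⟨y, b, rfl⟩ := hx
      refine AddSubgroup.subset_closure ⟨exac.extClass.comp y (add_comm 1 n), b, ?_⟩
      exact (Ext.comp_assoc _ _ _ (add_comm 1 n) (add_zero n) (by lia)).symm
    | zero => rw [map_zero]; exact AddSubgroup.zero_mem _
    | add x y _ _ hx hy => rw [map_add]; exact AddSubgroup.add_mem _ hx hy
    | neg x _ hx => rw [map_neg]; exact AddSubgroup.neg_mem _ hx

variable {B : Type} [CommRing B] [Algebra R B]

/-- If every element of `H^i_a(M)` is killed by an element of `S`, and `S` becomes invertible in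
the flat algebra `B`, then `H^i_a(B ⊗ M) = 0`. -/
lemma subsingleton_LC_tensorProduct [IsNoetherianRing R] [Module.Flat R B] (a : Ideal R) (i : ℕ)
    (M : Type) [AddCommGroup M] [Module R M] (S : Submonoid R)
    (hS : ∀ s ∈ S, IsUnit (algebraMap R B s)) (h : ∀ x : TopLC R a i M, ∃ s ∈ S, s • x = 0) :
    Subsingleton (LC a i (B ⊗[R] M)) := by
  have hinj : ∀ s ∈ S, ∀ x : LC a i (B ⊗[R] M), s • x = 0 → x = 0 := by
    intro s hs x hx
    obtain ⟨u, hu⟩ := (hS s hs).exists_right_inv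
    let g : B ⊗[R] M →ₗ[R] B ⊗[R] M := (LinearMap.lsmul B (B ⊗[R] M) u).restrictScalars R
    have hg : g ∘ₗ (s • LinearMap.id) = LinearMap.id := by
      refine LinearMap.ext fun v => ?_
      change u • (s • v) = v
      rw [← algebraMap_smul B s v, smul_smul, mul_comm, hu, one_smul]
    rw [← LC.map_id x, ← hg, LC.map_comp, LC.map_smul_id, hx, map_zero]
  refine subsingleton_of_forall_eq 0 fun x => ?_
  obtain ⟨n, e, rfl⟩ := LCCat.exists_of x
  suffices ∃ s ∈ S, s • LCCat.of n e = 0 by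
    obtain ⟨s, hs, hx⟩ := this
    exact hinj s hs _ hx
  have he := ext_tensorProduct_mem_closure B M i (ModuleCat.of R (R ⧸ a ^ n)) e
  induction he using AddSubgroup.closure_induction with
  | mem x hx =>
    obtain ⟨y, b, rfl⟩ := hx
    obtain ⟨m, hm, s, hs, h0⟩ := exists_smul_transition_eq_zero a i M S h n y
    refine ⟨s, hs, ?_⟩
    have h1 : s • LCCat.of n y = 0 := by
      rw [← LCCat.of_trans hm, ← map_smul]
      exact (congrArg (LCCat.of m) h0).trans (map_zero _)
    rw [← LCCat.op_of, ← map_smul, h1, map_zero]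
  | zero => exact ⟨1, S.one_mem, by simp⟩
  | add x y _ _ hx hy =>
    obtain ⟨s, hs, hx⟩ := hx
    obtain ⟨t, ht, hy⟩ := hy
    refine ⟨s * t, S.mul_mem hs ht, ?_⟩
    rw [map_add, smul_add, mul_smul s t (LCCat.of n y), hy, mul_comm, mul_smul, hx, smul_zero,
      smul_zero, add_zero]
  | neg x _ hx =>
    obtain ⟨s, hs, hx⟩ := hx
    exact ⟨s, hs, by rw [map_neg, smul_neg, hx, neg_zero]⟩

lemma HB.subsingleton_tensorProduct [IsNoetherianRing R] [Module.Flat R B] (a : Ideal R) (i : ℕ)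
    (M : Type) [AddCommGroup M] [Module R M] (S : Submonoid R)
    (hS : ∀ s ∈ S, IsUnit (algebraMap R B s)) (h : ∀ x : TopLC R a i M, ∃ s ∈ S, s • x = 0) :
    Subsingleton (HB (B := B) a i (B ⊗[R] M)) := by
  have := subsingleton_LC_tensorProduct a i M S hS h
  let f : B ⊗[R] M →ₗ[R] Res R B (B ⊗[R] M) :=
    { toFun := fun x => x
      map_add' := fun _ _ => rfl
      map_smul' := fun r x => (algebraMap_smul B r x).symm }
  let g : Res R B (B ⊗[R] M) →ₗ[R] B ⊗[R] M :=
    { toFun := fun x => x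
      map_add' := fun _ _ => rfl
      map_smul' := fun r x => algebraMap_smul B r (show B ⊗[R] M from x) }
  refine subsingleton_of_forall_eq 0 fun x => ?_
  have hfg : f ∘ₗ g = LinearMap.id := rfl
  rw [← LC.map_id x, ← hfg, LC.map_comp, Subsingleton.elim (LC.map a i g x) 0, map_zero]

end BaseChange

section Core
open Module IsLocalRing

variable {R B : Type} [CommRing R] [CommRing B] [Algebra R B]

lemma mem_support_tensorProduct {M : Type} [AddCommGroup M] [Module R M] [Module.Finite R M]
    {P : PrimeSpectrum B} (h : P.comap (algebraMap R B) ∈ support R M) :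
    P ∈ support B (B ⊗[R] M) := by
  let Q := P.comap (algebraMap R B)
  rw [mem_support_iff_nontrivial_residueField_tensorProduct] at h ⊢
  let φ : Q.asIdeal.ResidueField →+* P.asIdeal.ResidueField :=
    Ideal.ResidueField.map Q.asIdeal P.asIdeal (algebraMap R B) rfl
  let _ := φ.toAlgebra
  have : IsScalarTower R Q.asIdeal.ResidueField P.asIdeal.ResidueField :=
    .of_algebraMap_eq fun r => (IsScalarTower.algebraMap_apply R B _ r).trans
      (Ideal.ResidueField.map_algebraMap Q.asIdeal P.asIdeal _ rfl r).symm
  have h1 : Nontrivial (P.asIdeal.ResidueField ⊗[Q.asIdeal.ResidueField]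
    (Q.asIdeal.ResidueField ⊗[R] M)) := inferInstance
  have e1 := AlgebraTensorModule.cancelBaseChange R Q.asIdeal.ResidueField Q.asIdeal.ResidueField
    P.asIdeal.ResidueField M
  have e2 := AlgebraTensorModule.cancelBaseChange R B B P.asIdeal.ResidueField M
  have := e1.symm.toEquiv.nontrivial
  exact e2.toEquiv.nontrivial

variable [IsNoetherianRing R] [IsNoetherianRing B] [IsLocalRing B] [Module.Flat R B]

theorem mem_support_of_flat_local {a : Ideal R} {M : Type} [AddCommGroup M] [Module R M]
    [Module.Finite R M] {c : ℕ} (hc : cohDim R a M = (c : WithBot ℕ∞)) {p : PrimeSpectrum R}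
    (hcomap : (maximalIdeal B).comap (algebraMap R B) = p.asIdeal)
    (hmap : p.asIdeal.map (algebraMap R B) = maximalIdeal B)
    (hκ : p.asIdeal.IsMaximal → ∀ b : B, ∃ r : R, b - algebraMap R B r ∈ maximalIdeal B)
    (hap : a ≤ p.asIdeal) {q : PrimeSpectrum R} (hq : q ∈ support R M)
    (hqd : ringKrullDim (R ⧸ q.asIdeal) = c) {P : PrimeSpectrum B}
    (hqP : q.asIdeal ≤ P.asIdeal.comap (algebraMap R B)) (hPd : ringKrullDim (B ⧸ P.asIdeal) = c)
    (hP : ∀ Q : PrimeSpectrum B, P.asIdeal ≤ Q.asIdeal →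
      (∀ x ∈ a, algebraMap R B x ∈ Q.asIdeal) → Q.asIdeal = maximalIdeal B) :
    p ∈ support R (TopLC R a c M) := by
  by_contra hp
  have hmax : p.asIdeal.IsMaximal := isMaximal_of_ringKrullDim_eq hcomap hmap hqP hqd hPd
  refine HB.not_subsingleton (a := a) (fun x hx => ?_) (hκ hmax) P.asIdeal hP c P le_rfl hPd ?_
  · have := hap hx
    rwa [← hcomap] at this
  have hunit : ∀ s ∈ p.asIdeal.primeCompl, IsUnit (algebraMap R B s) := fun s hs => by
    by_contra h
    apply hs
    rw [← hcomap]
    exact (mem_maximalIdeal _).2 h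
  have hM : ∀ i ≥ c, Subsingleton (HB (B := B) a i (B ⊗[R] M)) := fun i hi => by
    refine HB.subsingleton_tensorProduct a i M p.asIdeal.primeCompl hunit fun x => ?_
    rcases hi.eq_or_lt with rfl | hi
    · exact notMem_support_iff'.1 hp x
    · have : Subsingleton (TopLC R a i M) := by
        rw [← not_nontrivial_iff_subsingleton]
        intro h
        have h1 : ((i : ℕ) : WithBot ℕ∞) ≤ cohDim R a M := le_sSup ⟨i, rfl, h⟩
        rw [hc] at h1
        exact absurd (by exact_mod_cast h1) hi.not_ge
      exact ⟨1, Submonoid.one_mem _, Subsingleton.elim _ _⟩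
  refine HB.subsingleton_of_support_subset hM (fun Q hQ => ?_) le_rfl
  have hPQ : P.asIdeal ≤ Q.asIdeal :=
    Ideal.annihilator_quotient.ge.trans (annihilator_le_of_mem_support hQ)
  refine mem_support_tensorProduct (mem_support_mono (p := q) ?_ hq)
  exact hqP.trans (Ideal.comap_mono hPQ)

end Core

section Final
open Module IsLocalRing

variable {R : Type} [CommRing R]

lemma adicCompletion_smul_eq_zero {A : Type} [CommRing A] (I : Ideal A) {N : Type} [AddCommGroup N]
    [Module A N] {z : A} (hz : ∀ v : N, z • v = 0) (y : AdicCompletion I N) :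
    algebraMap A (AdicCompletion I A) z • y = 0 := by
  rw [algebraMap_smul]
  ext n
  rw [AdicCompletion.val_smul_apply, AdicCompletion.val_zero_apply]
  obtain ⟨v, hv⟩ := Submodule.mkQ_surjective _ (y.val n)
  rw [← hv, ← map_smul, hz, map_zero]

lemma localizedModule_algebraMap_smul_eq_zero (S : Submonoid R) {N : Type} [AddCommGroup N]
    [Module R N] {x : R} (hx : ∀ v : N, x • v = 0) (v : LocalizedModule S N) :
    algebraMap R (Localization S) x • v = 0 := by
  rw [algebraMap_smul]
  induction v using LocalizedModule.induction_on with
  | _ m s => rw [LocalizedModule.smul'_mk, hx, LocalizedModule.zero_mk]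

variable [IsNoetherianRing R] (p : Ideal R) [p.IsPrime]

/-- The completed localization at a prime. -/
abbrev CompletedLocalization : Type :=
  AdicCompletion (maximalIdeal (Localization.AtPrime p)) (Localization.AtPrime p)

namespace CompletedLocalization

instance : IsNoetherianRing (Localization.AtPrime p) :=
  IsLocalization.isNoetherianRing p.primeCompl _ inferInstance

instance : IsScalarTower R (Localization.AtPrime p) (CompletedLocalization p) :=
  .of_algebraMap_eq fun _ => rfl

instance : Module.Flat R (CompletedLocalization p) :=
  have : Module.Flat R (Localization.AtPrime p) := IsLocalization.flat _ p.primeCompl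
  Module.Flat.trans R (Localization.AtPrime p) _

lemma comap_maximalIdeal :
    (maximalIdeal (CompletedLocalization p)).comap (algebraMap R (CompletedLocalization p)) = p := by
  rw [IsScalarTower.algebraMap_eq R (Localization.AtPrime p) (CompletedLocalization p),
    ← Ideal.comap_comap, IsLocalRing.maximalIdeal_comap]
  exact Localization.AtPrime.under_maximalIdeal

lemma map_eq_maximalIdeal :
    p.map (algebraMap R (CompletedLocalization p)) = maximalIdeal (CompletedLocalization p) := by
  rw [IsScalarTower.algebraMap_eq R (Localization.AtPrime p) (CompletedLocalization p),
    ← Ideal.map_map, Localization.AtPrime.map_eq_maximalIdeal, AdicCompletion.maximalIdeal_eq_map]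

lemma exists_sub_mem_maximalIdeal (hp : p.IsMaximal) (b : CompletedLocalization p) :
    ∃ r : R, b - algebraMap R (CompletedLocalization p) r ∈ maximalIdeal (CompletedLocalization p) := by
  obtain ⟨y, hy⟩ := (AdicCompletion.residueField_map_bijective (Localization.AtPrime p)).2
    (residue _ b)
  obtain ⟨r, rfl⟩ := p.algebraMap_residueField_surjective y
  refine ⟨r, Ideal.Quotient.eq.1 ?_⟩
  exact hy.symm

end CompletedLocalization

lemma exists_le_of_iInf_le (X : Set (PrimeSpectrum R)) {M : Type} [AddCommGroup M] [Module R M]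
    [Module.Finite R M] (hX : ∀ q ∈ X, q.asIdeal ∈ associatedPrimes R M) {J : Ideal R}
    (hJ : J.IsPrime) (h : ⨅ q ∈ X, q.asIdeal ≤ J) : ∃ q ∈ X, q.asIdeal ≤ J := by
  have hfin : X.Finite := Set.Finite.of_finite_image
    ((associatedPrimes.finite R M).subset (Set.image_subset_iff.2 hX))
    (fun _ _ _ _ h => PrimeSpectrum.ext h)
  obtain ⟨q, hq, hqJ⟩ := (hJ.inf_le' (s := hfin.toFinset) (f := PrimeSpectrum.asIdeal)).1 (by
    rw [Finset.inf_eq_iInf]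
    simpa using h)
  exact ⟨q, by simpa using hq, hqJ⟩

end Final

/-- Let `c := cd_R(a, M) ≠ -∞` for a finitely generated module `M`, let
`W = { p ∈ Supp_R M : dim R/p = cd_R(a, R/p) = c }`, `X = W ∩ Ass_R M` and
`b = ∩_{p ∈ X} p`. Then `P_{a,R/b} ⊆ Supp_R H^c_a(M)`. -/
theorem stmt_11 (R : Type) [CommRing R] [IsNoetherianRing R] (a : Ideal R)
    (M : Type) [AddCommGroup M] [Module R M] [Module.Finite R M]
    (c : ℕ) (hc : cohDim R a M = (c : WithBot ℕ∞))
    (W : Set (PrimeSpectrum R))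
    (hW : W = { p ∈ Module.support R M |
      ringKrullDim (R ⧸ p.asIdeal) = (c : WithBot ℕ∞) ∧
      cohDim R a (R ⧸ p.asIdeal) = (c : WithBot ℕ∞) })
    (X : Set (PrimeSpectrum R)) (hX : X = { p ∈ W | p.asIdeal ∈ associatedPrimes R M })
    (b : Ideal R) (hb : b = ⨅ p ∈ X, p.asIdeal) :
    Pset R a (R ⧸ b) c ⊆ Module.support R (TopLC R a c M) := by
  subst hb hX hW
  rintro p ⟨hpa, P, hPsupp, hPd, hP0⟩
  have hb : ⨅ q ∈ {q ∈ { p ∈ Module.support R M |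
      ringKrullDim (R ⧸ p.asIdeal) = (c : WithBot ℕ∞) ∧
      cohDim R a (R ⧸ p.asIdeal) = (c : WithBot ℕ∞) } | q.asIdeal ∈ associatedPrimes R M},
      q.asIdeal ≤ P.asIdeal.comap (algebraMap R (CompletedLocalization p.asIdeal)) := by
    intro x hx
    refine Module.annihilator_le_of_mem_support hPsupp (Module.mem_annihilator.2 fun y => ?_)
    refine adicCompletion_smul_eq_zero _ (localizedModule_algebraMap_smul_eq_zero _ fun v => ?_) y
    rw [← Ideal.annihilator_quotient (I := iInf _)] at hx
    exact Module.mem_annihilator.1 hx v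
  obtain ⟨q, hq, hqP⟩ := exists_le_of_iInf_le _ (fun q hq => hq.2) (P.2.comap _) hb
  refine mem_support_of_flat_local hc (CompletedLocalization.comap_maximalIdeal p.asIdeal)
    (CompletedLocalization.map_eq_maximalIdeal p.asIdeal)
    (CompletedLocalization.exists_sub_mem_maximalIdeal p.asIdeal) (le_sup_right.trans hpa)
    hq.1.1 hq.1.2.1 hqP hPd fun Q hPQ haQ => ?_
  refine HB.eq_maximalIdeal_of_ringKrullDim_zero (le_trans ?_ hP0.le)
  refine ringKrullDim_le_of_surjective (Ideal.Quotient.factor (sup_le ?_ hPQ))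
    (Ideal.Quotient.factor_surjective _)
  rw [Ideal.map_map, Ideal.map_le_iff_le_comap]
  exact haQ
end
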